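/- arXiv:1811.01600 — 4 statements merged into one kernel-verified Lean document; each statement's English description precedes it below -/
import Mathlib

section
/- Given a matroid M = ([n], 𝓘) with I_k independent sets of size k and rank r, the bivariate polynomial f_M(y, z) = Σ_{k=0}^{r} I_k · y^{n−k} · z^k is completely log-concave. -/
open Matrix MvPolynomial

structure PaperMatroid (n : ℕ) where
  Indep : Finset (Fin n) → Prop
  indep_nonempty : ∃ S, Indep S
  indep_subset : ∀ ⦃S T : Finset (Fin n)⦄, S ⊆ T → Indep T → Indep S
  indep_exchange : ∀ ⦃S T : Finset (Fin n)⦄, Indep S → Indep T → S.card < T.card →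
    ∃ i ∈ T \ S, Indep (insert i S)

/-- The number of independent sets of cardinality `k`. -/
noncomputable def numIndep {n : ℕ} (M : PaperMatroid n) (k : ℕ) : ℕ :=
  Nat.card {S : Finset (Fin n) // M.Indep S ∧ S.card = k}

/- The rank of the matroid: the size of the largest independent set. -/
open Classical in
noncomputable def matRank {n : ℕ} (M : PaperMatroid n) : ℕ :=
  Finset.sup (Finset.univ.filter fun S => M.Indep S) Finset.card

/-- The directional derivative operator `D_v = ∑ i, v i • ∂_i`. -/
noncomputable def dirDeriv {m : ℕ} (v : Fin m → ℝ) (f : MvPolynomial (Fin m) ℝ) :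
    MvPolynomial (Fin m) ℝ :=
  ∑ i, MvPolynomial.C (v i) * MvPolynomial.pderiv i f

/-- `f` is nonnegative and log-concave as a function on the nonnegative orthant. -/
def LogConcaveOn {m : ℕ} (f : MvPolynomial (Fin m) ℝ) : Prop :=
  (∀ x : Fin m → ℝ, (∀ i, 0 ≤ x i) → 0 ≤ MvPolynomial.eval x f) ∧
  ∀ u v : Fin m → ℝ, (∀ i, 0 ≤ u i) → (∀ i, 0 ≤ v i) →
    ∀ t : ℝ, 0 ≤ t → t ≤ 1 →
      (MvPolynomial.eval u f) ^ t * (MvPolynomial.eval v f) ^ (1 - t) ≤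
        MvPolynomial.eval (fun i => t * u i + (1 - t) * v i) f

/-- `f` is completely log-concave: every iterated directional derivative along
nonnegative directions is nonnegative and log-concave on the nonnegative orthant. -/
def CompletelyLogConcave {m : ℕ} (f : MvPolynomial (Fin m) ℝ) : Prop :=
  ∀ (k : ℕ) (v : Fin k → Fin m → ℝ), (∀ j i, 0 ≤ v j i) →
    LogConcaveOn ((List.ofFn v).foldr dirDeriv f)

/-- The bivariate polynomial `f_M(y,z) = ∑_{k=0}^{r} I_k y^(n-k) z^k`, where
variable `0` is `y` and variable `1` is `z`. -/
noncomputable def fM {n : ℕ} (M : PaperMatroid n) : MvPolynomial (Fin 2) ℝ :=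
  ∑ k ∈ Finset.range (matRank M + 1),
    MvPolynomial.C (numIndep M k : ℝ) * MvPolynomial.X 0 ^ (n - k) * MvPolynomial.X 1 ^ k

/-- The operator `c ↦ x₀ c + x₁ S c` on sequences, where `S` is the left shift. -/
def shiftComb (x : Fin 2 → ℝ) (c : ℕ → ℝ) : ℕ → ℝ := fun k => x 0 * c k + x 1 * c (k + 1)

/-- Nonnegative log-concave sequences without internal zeros. -/
def IsLogConcaveSeq (c : ℕ → ℝ) : Prop :=
  (∀ k, 0 ≤ c k) ∧ ∀ i j, i ≤ j → c i * c (j + 1) ≤ c (i + 1) * c j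

/-- The binary form of degree `d` with coefficients `d.choose k * c k`. -/
noncomputable def binaryForm : ℕ → (ℕ → ℝ) → MvPolynomial (Fin 2) ℝ
  | 0, c => C (c 0)
  | d + 1, c => X 0 * binaryForm d c + X 1 * binaryForm d (fun k => c (k + 1))

lemma IsLogConcaveSeq.map_shiftComb {c : ℕ → ℝ} (hc : IsLogConcaveSeq c) {x : Fin 2 → ℝ}
    (hx : ∀ i, 0 ≤ x i) : IsLogConcaveSeq (shiftComb x c) := by
  obtain ⟨h0, h1⟩ := hc
  refine ⟨fun k => ?_, fun i j hij => ?_⟩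
  · have := mul_nonneg (hx 0) (h0 k)
    have := mul_nonneg (hx 1) (h0 (k + 1))
    unfold shiftComb; linarith
  · have key : c i * c (j + 2) ≤ c (i + 2) * c j := by
      rcases hij.eq_or_lt with rfl | h
      · exact (mul_comm _ _).le
      · exact (h1 i (j + 1) (by omega)).trans (h1 (i + 1) j h)
    have e1 := mul_le_mul_of_nonneg_left (h1 i j hij) (mul_nonneg (hx 0) (hx 0))
    have e2 := mul_le_mul_of_nonneg_left (h1 (i + 1) (j + 1) (by omega))
      (mul_nonneg (hx 1) (hx 1))
    have e3 := mul_le_mul_of_nonneg_left key (mul_nonneg (hx 0) (hx 1))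
    unfold shiftComb
    simp only [add_assoc, Nat.reduceAdd] at *
    linarith

lemma IsLogConcaveSeq.smul {c : ℕ → ℝ} (hc : IsLogConcaveSeq c) {r : ℝ} (hr : 0 ≤ r) :
    IsLogConcaveSeq (r • c) := by
  refine ⟨fun k => mul_nonneg hr (hc.1 k), fun i j hij => ?_⟩
  have := mul_le_mul_of_nonneg_left (hc.2 i j hij) (mul_nonneg hr hr)
  simp only [Pi.smul_apply, smul_eq_mul]
  linarith

lemma IsLogConcaveSeq.iterate {c : ℕ → ℝ} (hc : IsLogConcaveSeq c) {x : Fin 2 → ℝ}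
    (hx : ∀ i, 0 ≤ x i) (d : ℕ) : IsLogConcaveSeq ((shiftComb x)^[d] c) := by
  induction d generalizing c with
  | zero => exact hc
  | succ d ih => exact ih (hc.map_shiftComb hx)

lemma shiftComb_comm (x y : Fin 2 → ℝ) (c : ℕ → ℝ) :
    shiftComb x (shiftComb y c) = shiftComb y (shiftComb x c) := by
  funext k; simp only [shiftComb]; ring

lemma shiftComb_iterate_comm (x y : Fin 2 → ℝ) (d : ℕ) (c : ℕ → ℝ) :
    (shiftComb x)^[d] (shiftComb y c) = shiftComb y ((shiftComb x)^[d] c) :=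
  (Function.Commute.iterate_left (fun c => shiftComb_comm x y c) d) c

lemma binaryForm_succ (d : ℕ) (c : ℕ → ℝ) :
    binaryForm (d + 1) c = X 0 * binaryForm d c + X 1 * binaryForm d (fun k => c (k + 1)) := rfl

lemma binaryForm_combine (d : ℕ) (a b : ℝ) (c e : ℕ → ℝ) :
    binaryForm d (fun k => a * c k + b * e k) =
      C a * binaryForm d c + C b * binaryForm d e := by
  induction d generalizing c e with
  | zero => simp [binaryForm]
  | succ d ih =>
    simp only [binaryForm]
    rw [ih c e, ih (fun k => c (k + 1)) (fun k => e (k + 1))]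
    ring

lemma binaryForm_smul (d : ℕ) (r : ℝ) (c : ℕ → ℝ) :
    binaryForm d (r • c) = C r * binaryForm d c := by
  have := binaryForm_combine d r 0 c c
  simp only [zero_mul, add_zero, map_zero] at this
  exact this

lemma eval_binaryForm (d : ℕ) (c : ℕ → ℝ) (x : Fin 2 → ℝ) :
    eval x (binaryForm d c) = (shiftComb x)^[d] c 0 := by
  induction d generalizing c with
  | zero => simp [binaryForm]
  | succ d ih =>
    rw [Function.iterate_succ_apply, ← ih]
    unfold shiftComb
    rw [binaryForm_combine]
    simp [binaryForm]

lemma dirDeriv_mul {m : ℕ} (v : Fin m → ℝ) (f g : MvPolynomial (Fin m) ℝ) :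
    dirDeriv v (f * g) = f * dirDeriv v g + dirDeriv v f * g := by
  simp only [dirDeriv, Finset.mul_sum, Finset.sum_mul, ← Finset.sum_add_distrib]
  refine Finset.sum_congr rfl fun i _ => ?_
  rw [Derivation.leibniz, smul_eq_mul, smul_eq_mul]
  ring

lemma dirDeriv_add {m : ℕ} (v : Fin m → ℝ) (f g : MvPolynomial (Fin m) ℝ) :
    dirDeriv v (f + g) = dirDeriv v f + dirDeriv v g := by
  simp only [dirDeriv, map_add, mul_add, Finset.sum_add_distrib]

lemma dirDeriv_binaryForm_zero (v : Fin 2 → ℝ) (c : ℕ → ℝ) :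
    dirDeriv v (binaryForm 0 c) = binaryForm 0 0 := by
  simp [dirDeriv, binaryForm]

lemma dirDeriv_binaryForm_succ (v : Fin 2 → ℝ) (d : ℕ) (c : ℕ → ℝ) :
    dirDeriv v (binaryForm (d + 1) c) = binaryForm d (((d : ℝ) + 1) • shiftComb v c) := by
  have hX0 : dirDeriv v (X 0) = C (v 0) := by simp [dirDeriv, pderiv_X]
  have hX1 : dirDeriv v (X 1) = C (v 1) := by simp [dirDeriv, pderiv_X]
  have hsh (d : ℕ) : binaryForm d (shiftComb v c) =
      C (v 0) * binaryForm d c + C (v 1) * binaryForm d (fun k => c (k + 1)) :=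
    binaryForm_combine d _ _ _ _
  induction d generalizing c with
  | zero =>
    rw [binaryForm_succ, dirDeriv_add, dirDeriv_mul, dirDeriv_mul, hX0, hX1,
      dirDeriv_binaryForm_zero, dirDeriv_binaryForm_zero, binaryForm_smul, hsh]
    simp [binaryForm]
  | succ d ih =>
    have hstep (c : ℕ → ℝ) := ih c (fun d => binaryForm_combine d _ _ _ _)
    rw [binaryForm_succ, dirDeriv_add, dirDeriv_mul, dirDeriv_mul, hX0, hX1, hstep, hstep,
      binaryForm_smul, binaryForm_smul, binaryForm_smul]
    have e : binaryForm (d + 1) (shiftComb v c) = X 0 * binaryForm d (shiftComb v c) +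
        X 1 * binaryForm d (shiftComb v fun k => c (k + 1)) := rfl
    have e2 := hsh (d + 1)
    simp only [map_add, map_one, Nat.cast_add, Nat.cast_one]
    linear_combination (-1 : MvPolynomial (Fin 2) ℝ) * e2 - C (d : ℝ) * e - e

lemma foldr_dirDeriv_binaryForm (d : ℕ) (c : ℕ → ℝ) (hc : IsLogConcaveSeq c)
    (l : List (Fin 2 → ℝ)) (hl : ∀ v ∈ l, ∀ i, 0 ≤ v i) :
    ∃ d' c', IsLogConcaveSeq c' ∧ l.foldr dirDeriv (binaryForm d c) = binaryForm d' c' := by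
  induction l with
  | nil => exact ⟨d, c, hc, rfl⟩
  | cons v l ih =>
    obtain ⟨d', c', hc', h⟩ := ih fun w hw => hl w (List.mem_cons_of_mem _ hw)
    rw [List.foldr_cons, h]
    cases d' with
    | zero => exact ⟨0, 0, ⟨fun _ => le_rfl, fun _ _ _ => by simp⟩, dirDeriv_binaryForm_zero _ _⟩
    | succ d' =>
      exact ⟨d', _, (hc'.map_shiftComb (hl v List.mem_cons_self)).smul (by positivity),
        dirDeriv_binaryForm_succ _ _ _⟩

lemma iterate_shiftComb_eq_zero_iff {x : Fin 2 → ℝ} (hx : ∀ i, 0 < x i) (d : ℕ) {c : ℕ → ℝ}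
    (hc : ∀ k, 0 ≤ c k) : (shiftComb x)^[d] c 0 = 0 ↔ ∀ k ≤ d, c k = 0 := by
  induction d generalizing c with
  | zero => simp
  | succ d ih =>
    have h0 (k : ℕ) : 0 ≤ x 0 * c k := mul_nonneg (hx 0).le (hc k)
    have h1 (k : ℕ) : 0 ≤ x 1 * c (k + 1) := mul_nonneg (hx 1).le (hc (k + 1))
    rw [Function.iterate_succ_apply, ih (c := shiftComb x c) (fun k => add_nonneg (h0 k) (h1 k))]
    constructor
    · intro h k hk
      have e (k : ℕ) (hk : k ≤ d) : c k = 0 ∧ c (k + 1) = 0 := by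
        have := h k hk
        rw [shiftComb, add_eq_zero_iff_of_nonneg (h0 k) (h1 k)] at this
        simpa [(hx 0).ne', (hx 1).ne'] using this
      rcases hk.eq_or_lt with rfl | hk
      · exact (e d le_rfl).2
      · exact (e k (by omega)).1
    · intro h k hk
      simp [shiftComb, h k (by omega), h (k + 1) (by omega)]

lemma IsLogConcaveSeq.reverse_cauchy {c : ℕ → ℝ} (hc : IsLogConcaveSeq c) (u w : Fin 2 → ℝ) :
    shiftComb u (shiftComb u c) 0 * shiftComb w (shiftComb w c) 0 ≤
      shiftComb w (shiftComb u c) 0 ^ 2 := by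
  have h := mul_nonneg (sub_nonneg.2 (hc.2 0 1 zero_le_one)) (sq_nonneg (u 0 * w 1 - u 1 * w 0))
  simp only [shiftComb, zero_add, Nat.reduceAdd] at *
  nlinarith [h, hc.2 0 0 le_rfl]

lemma IsLogConcaveSeq.pow_mul_le {u w : Fin 2 → ℝ} (hu : ∀ i, 0 < u i) (hw : ∀ i, 0 < w i)
    (d : ℕ) {c : ℕ → ℝ} (hc : IsLogConcaveSeq c) :
    (shiftComb u)^[d + 1] c 0 * ((shiftComb w)^[d + 1] c 0) ^ d ≤
      ((shiftComb w)^[d] (shiftComb u c) 0) ^ (d + 1) := by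
  induction d generalizing c with
  | zero => simp
  | succ d ih =>
    have hg := hc.map_shiftComb (fun i => (hu i).le)
    have IH := ih hg
    set a := (shiftComb w)^[d + 1] (shiftComb u c) 0 with ha
    have ha0 : 0 ≤ a := (hg.iterate (fun i => (hw i).le) (d + 1)).1 0
    have hf0 : 0 ≤ (shiftComb w)^[d + 1 + 1] c 0 :=
      (hc.iterate (fun i => (hw i).le) (d + 1 + 1)).1 0
    rcases ha0.eq_or_lt with h0 | h0
    · have hz := (iterate_shiftComb_eq_zero_iff hw (d + 1) hg.1).1 h0.symm
      have : (shiftComb u)^[d + 1 + 1] c 0 = 0 := by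
        rw [Function.iterate_succ_apply]
        exact (iterate_shiftComb_eq_zero_iff hu (d + 1) hg.1).2 hz
      rw [this, zero_mul]
      positivity
    · have af := (hc.iterate (fun i => (hw i).le) d).reverse_cauchy u w
      have hs (k : ℕ) (e : ℕ → ℝ) : shiftComb w ((shiftComb w)^[k] e) = (shiftComb w)^[k + 1] e :=
        (Function.iterate_succ_apply' _ _ _).symm
      rw [← shiftComb_iterate_comm w u, ← shiftComb_iterate_comm w u, hs, hs, hs, ← ha] at af
      rw [← Function.iterate_succ_apply] at IH
      set f := (shiftComb w)^[d + 1 + 1] c 0 with hf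
      set b := (shiftComb w)^[d] (shiftComb u (shiftComb u c)) 0 with hb
      have hb0 : 0 ≤ b :=
        ((hg.map_shiftComb (fun i => (hu i).le)).iterate (fun i => (hw i).le) d).1 0
      refine le_of_mul_le_mul_right ?_ (pow_pos h0 d)
      calc (shiftComb u)^[d + 1 + 1] c 0 * f ^ (d + 1) * a ^ d
          = ((shiftComb u)^[d + 1 + 1] c 0 * a ^ d) * f ^ (d + 1) := by ring
        _ ≤ b ^ (d + 1) * f ^ (d + 1) := by gcongr
        _ = (b * f) ^ (d + 1) := by rw [mul_pow]
        _ ≤ (a ^ 2) ^ (d + 1) := by gcongr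
        _ = a ^ (d + 1 + 1) * a ^ d := by ring

lemma shiftComb_iterate_combine (d : ℕ) (x : Fin 2 → ℝ) (s t : ℝ) (c e : ℕ → ℝ) :
    (shiftComb x)^[d] (fun k => s * c k + t * e k) 0 =
      s * (shiftComb x)^[d] c 0 + t * (shiftComb x)^[d] e 0 := by
  simp only [← eval_binaryForm, binaryForm_combine, map_add, map_mul, eval_C]

lemma IsLogConcaveSeq.rpow_mul_rpow_le_of_pos {u v : Fin 2 → ℝ} (hu : ∀ i, 0 < u i)
    (hv : ∀ i, 0 < v i) {t : ℝ} (ht0 : 0 < t) (ht1 : t < 1) (d : ℕ) {c : ℕ → ℝ}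
    (hc : IsLogConcaveSeq c) :
    (shiftComb u)^[d] c 0 ^ t * (shiftComb v)^[d] c 0 ^ (1 - t) ≤
      (shiftComb (fun i => t * u i + (1 - t) * v i))^[d] c 0 := by
  have ht1' : 0 < 1 - t := sub_pos.2 ht1
  cases d with
  | zero =>
    simp only [Function.iterate_zero, id]
    rw [← Real.rpow_add' (hc.1 0) (by norm_num)]
    norm_num
  | succ d =>
    set w : Fin 2 → ℝ := fun i => t * u i + (1 - t) * v i with hwdef
    have hw (i) : 0 < w i := add_pos (mul_pos ht0 (hu i)) (mul_pos ht1' (hv i))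
    have hA := hc.pow_mul_le hu hw d
    have hB := hc.pow_mul_le hv hw d
    have hsum : (shiftComb w)^[d + 1] c 0 =
        t * (shiftComb w)^[d] (shiftComb u c) 0 +
          (1 - t) * (shiftComb w)^[d] (shiftComb v c) 0 := by
      rw [Function.iterate_succ_apply, ← shiftComb_iterate_combine]
      have e : shiftComb w c = fun k => t * shiftComb u c k + (1 - t) * shiftComb v c k := by
        funext k
        simp only [shiftComb, hwdef]
        ring
      rw [e]
    have hA0 : 0 ≤ (shiftComb w)^[d] (shiftComb u c) 0 :=
      ((hc.map_shiftComb fun i => (hu i).le).iterate (fun i => (hw i).le) d).1 0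
    have hB0 : 0 ≤ (shiftComb w)^[d] (shiftComb v c) 0 :=
      ((hc.map_shiftComb fun i => (hv i).le).iterate (fun i => (hw i).le) d).1 0
    have hU : 0 ≤ (shiftComb u)^[d + 1] c 0 := (hc.iterate (fun i => (hu i).le) (d + 1)).1 0
    have hV : 0 ≤ (shiftComb v)^[d + 1] c 0 := (hc.iterate (fun i => (hv i).le) (d + 1)).1 0
    have hW : 0 ≤ (shiftComb w)^[d + 1] c 0 := (hc.iterate (fun i => (hw i).le) (d + 1)).1 0
    rcases hW.eq_or_lt with h0 | h0
    · have hz := (iterate_shiftComb_eq_zero_iff hw (d + 1) hc.1).1 h0.symm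
      rw [(iterate_shiftComb_eq_zero_iff hu (d + 1) hc.1).2 hz, Real.zero_rpow ht0.ne', zero_mul]
      exact hW
    · set f := (shiftComb w)^[d + 1] c 0
      set A := (shiftComb w)^[d] (shiftComb u c) 0
      set B := (shiftComb w)^[d] (shiftComb v c) 0
      set U := (shiftComb u)^[d + 1] c 0
      set V := (shiftComb v)^[d + 1] c 0
      have amgm : A ^ t * B ^ (1 - t) ≤ f := by
        rw [hsum]
        exact Real.geom_mean_le_arith_mean2_weighted ht0.le ht1'.le hA0 hB0 (by ring)
      refine le_of_mul_le_mul_right ?_ (pow_pos h0 d)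
      have hfd : 0 ≤ f ^ d := pow_nonneg hW d
      calc U ^ t * V ^ (1 - t) * f ^ d
          = U ^ t * V ^ (1 - t) * ((f ^ d) ^ t * (f ^ d) ^ (1 - t)) := by
            rw [← Real.rpow_add' hfd (by norm_num)]; norm_num
        _ = (U * f ^ d) ^ t * (V * f ^ d) ^ (1 - t) := by
            rw [Real.mul_rpow hU hfd, Real.mul_rpow hV hfd]; ring
        _ ≤ (A ^ (d + 1)) ^ t * (B ^ (d + 1)) ^ (1 - t) := by gcongr
        _ = (A ^ t * B ^ (1 - t)) ^ (d + 1) := by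
            rw [mul_pow, ← Real.rpow_natCast, ← Real.rpow_natCast, ← Real.rpow_natCast,
              ← Real.rpow_natCast, ← Real.rpow_mul hA0, ← Real.rpow_mul hA0, ← Real.rpow_mul hB0,
              ← Real.rpow_mul hB0, mul_comm t, mul_comm (1 - t)]
        _ ≤ f ^ (d + 1) := by gcongr
        _ = f * f ^ d := by ring

lemma logConcaveOn_binaryForm (d : ℕ) {c : ℕ → ℝ} (hc : IsLogConcaveSeq c) :
    LogConcaveOn (binaryForm d c) := by
  refine ⟨fun x hx => ?_, fun u v hu hv t ht0 ht1 => ?_⟩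
  · rw [eval_binaryForm]
    exact (hc.iterate hx d).1 0
  rcases ht0.eq_or_lt with rfl | ht0
  · simp
  rcases ht1.eq_or_lt with rfl | ht1
  · simp
  have hcont : Continuous fun x => eval x (binaryForm d c) := MvPolynomial.continuous_eval _
  have hpert (x : Fin 2 → ℝ) : Continuous fun ε : ℝ => fun i => x i + ε := by fun_prop
  have hlim (x : Fin 2 → ℝ) : Filter.Tendsto (fun ε : ℝ => eval (fun i => x i + ε) (binaryForm d c))
      (nhdsWithin 0 (Set.Ioi 0)) (nhds (eval x (binaryForm d c))) := by
    have := (hcont.comp (hpert x)).tendsto 0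
    simp only [Function.comp_apply, add_zero] at this
    exact this.mono_left nhdsWithin_le_nhds
  refine le_of_tendsto_of_tendsto
    (((hlim u).rpow_const (Or.inr ht0.le)).mul ((hlim v).rpow_const (Or.inr (sub_nonneg.2 ht1.le))))
    (hlim fun i => t * u i + (1 - t) * v i) ?_
  filter_upwards [self_mem_nhdsWithin] with ε hε
  have hε : 0 < ε := hε
  have := hc.rpow_mul_rpow_le_of_pos (u := fun i => u i + ε) (v := fun i => v i + ε)
    (fun i => add_pos_of_nonneg_of_pos (hu i) hε) (fun i => add_pos_of_nonneg_of_pos (hv i) hε)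
    ht0 ht1 d
  simp only [← eval_binaryForm] at this
  refine this.trans (le_of_eq ?_)
  congr 2
  funext i
  ring

/-- Binary forms with ultra-log-concave coefficients are completely log-concave. -/
lemma completelyLogConcave_binaryForm (d : ℕ) {c : ℕ → ℝ} (hc : IsLogConcaveSeq c) :
    CompletelyLogConcave (binaryForm d c) := by
  intro k v hv
  obtain ⟨d', c', hc', h⟩ := foldr_dirDeriv_binaryForm d c hc (List.ofFn v) (by
    intro w hw
    obtain ⟨j, rfl⟩ := (List.mem_ofFn' v w).1 hw
    exact hv j)
  rw [h]
  exact logConcaveOn_binaryForm d' hc'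

lemma binaryForm_eq_sum (d : ℕ) (c : ℕ → ℝ) : binaryForm d c =
    ∑ p ∈ Finset.HasAntidiagonal.antidiagonal d, (d.choose p.1 : MvPolynomial (Fin 2) ℝ) *
      (C (c p.2) * X 0 ^ p.1 * X 1 ^ p.2) := by
  induction d generalizing c with
  | zero => simp [binaryForm]
  | succ d ih =>
    rw [Finset.sum_antidiagonal_choose_succ_mul
      (fun i j => (C (c j) * X 0 ^ i * X 1 ^ j : MvPolynomial (Fin 2) ℝ)) d, binaryForm_succ,
      ih, ih, Finset.mul_sum, Finset.mul_sum, add_comm]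
    congr 1
    · refine Finset.sum_congr rfl fun p hp => ?_
      rw [← Finset.HasAntidiagonal.mem_antidiagonal.1 hp, Nat.choose_symm_add]
      ring
    · refine Finset.sum_congr rfl fun p hp => ?_
      rw [← Finset.HasAntidiagonal.mem_antidiagonal.1 hp, Nat.choose_symm_add]
      ring

lemma le_sum_sq_div_of_forall_le {κ : Type*} [Fintype κ] [DecidableEq κ] (c : ℝ) (q l : κ → ℝ)
    (H : ∀ g : κ → ℝ, c + 2 * ∑ j, q j * g j + ∑ j, l j * g j ^ 2 ≤
      ∑ j, (q j + l j * g j) ^ 2) :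
    (∀ j, l j = 0 → q j = 0) ∧ c ≤ ∑ j, q j ^ 2 / l j := by
  have hz : ∀ j, l j = 0 → q j = 0 := by
    intro i hi
    by_contra hq
    have key (t : ℝ) := H (Function.update 0 i t)
    have e1 (t : ℝ) : ∑ j, q j * Function.update (0 : κ → ℝ) i t j = q i * t := by
      rw [Finset.sum_eq_single i] <;> simp +contextual [Function.update_of_ne]
    have e2 (t : ℝ) : ∑ j, l j * Function.update (0 : κ → ℝ) i t j ^ 2 = 0 := by
      refine Finset.sum_eq_zero fun j _ => ?_
      by_cases h : j = i
      · subst h; simp [hi]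
      · simp [Function.update_of_ne h]
    have e3 (t : ℝ) : ∑ j, (q j + l j * Function.update (0 : κ → ℝ) i t j) ^ 2 = ∑ j, q j ^ 2 := by
      refine Finset.sum_congr rfl fun j _ => ?_
      by_cases h : j = i
      · subst h; simp [hi]
      · simp [Function.update_of_ne h]
    have := key ((∑ j, q j ^ 2 - c + 1) / (2 * q i))
    rw [e1, e2, e3] at this
    field_simp at this
    linarith
  refine ⟨hz, ?_⟩
  have h := H fun j => -q j / l j
  have e : 2 * ∑ j, q j * (-q j / l j) + ∑ j, l j * (-q j / l j) ^ 2 -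
      ∑ j, (q j + l j * (-q j / l j)) ^ 2 = - ∑ j, q j ^ 2 / l j := by
    rw [Finset.mul_sum, ← Finset.sum_add_distrib, ← Finset.sum_sub_distrib,
      ← Finset.sum_neg_distrib]
    refine Finset.sum_congr rfl fun j _ => ?_
    by_cases hj : l j = 0
    · simp [hj, hz j hj]
    · field_simp; ring
  linarith

open scoped InnerProductSpace in
/-- If all positive eigenvalues of `T` belong to the fixed vector `e`, then a quadratic form
extending `⟪h, T h⟫` by one variable, and bounded by the squared norm of its gradient,
satisfies the reverse Cauchy-Schwarz inequality with respect to `e`. -/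
lemma norm_sq_mul_le_inner_sq {E : Type*} [NormedAddCommGroup E] [InnerProductSpace ℝ E]
    [FiniteDimensional ℝ E] (T : E →ₗ[ℝ] E) (hT : T.IsSymmetric) (c : ℝ) (q e : E)
    (h1 : ∀ (a : ℝ) (h : E), c * a ^ 2 + 2 * a * ⟪q, h⟫_ℝ + ⟪h, T h⟫_ℝ ≤ ‖a • q + T h‖ ^ 2)
    (h2 : ∀ h : E, ‖h‖ ^ 2 ≤ ⟪h, T h⟫_ℝ → ∃ t : ℝ, h = t • e) (a : ℝ) (h : E) :
    ‖e‖ ^ 2 * (c * a ^ 2 + 2 * a * ⟪q, h⟫_ℝ + ⟪h, T h⟫_ℝ) ≤ ⟪a • q + T h, e⟫_ℝ ^ 2 := by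
  set b := hT.eigenvectorBasis rfl with hb
  set l := hT.eigenvalues rfl with hl
  have hTb (j) : T (b j) = l j • b j := hT.apply_eigenvectorBasis rfl j
  have cT (j) (h : E) : ⟪b j, T h⟫_ℝ = l j * ⟪b j, h⟫_ℝ := by
    rw [← hT, hTb, real_inner_smul_left]
  have cI (x y : E) : ⟪x, y⟫_ℝ = ∑ j, ⟪b j, x⟫_ℝ * ⟪b j, y⟫_ℝ := by
    rw [← b.sum_inner_mul_inner x y]
    exact Finset.sum_congr rfl fun j _ => by rw [real_inner_comm]
  have cN (x : E) : ‖x‖ ^ 2 = ∑ j, ⟪b j, x⟫_ℝ ^ 2 := by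
    rw [← real_inner_self_eq_norm_sq, cI]
    exact Finset.sum_congr rfl fun j _ => by ring
  have cQ (h : E) : ⟪h, T h⟫_ℝ = ∑ j, l j * ⟪b j, h⟫_ℝ ^ 2 := by
    rw [cI]
    exact Finset.sum_congr rfl fun j _ => by rw [cT]; ring
  obtain ⟨hz, hc⟩ := le_sum_sq_div_of_forall_le c (fun j => ⟪b j, q⟫_ℝ) l (by
    intro g
    have hg (j) : ⟪b j, ∑ i, g i • b i⟫_ℝ = g j := b.orthonormal.inner_right_fintype g j
    have := h1 1 (∑ i, g i • b i)
    rw [cQ, cI q, cN] at this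
    simpa only [one_pow, mul_one, one_smul, inner_add_right, cT, hg] using this)
  have hpos (j) (hj : 0 < l j) : 1 ≤ l j ∧ ∃ t : ℝ, b j = t • e := by
    have hn : ‖b j‖ = 1 := b.norm_eq_one j
    have h3 : ⟪b j, T (b j)⟫_ℝ = l j := by
      rw [hTb, real_inner_smul_right, real_inner_self_eq_norm_sq, hn]; ring
    have h4 := h1 0 (b j)
    rw [h3, zero_smul, zero_add, hTb, norm_smul, hn] at h4
    have h5 : 1 ≤ l j := by
      simp only [Real.norm_eq_abs, mul_one, sq_abs] at h4
      nlinarith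
    exact ⟨h5, h2 _ (by rw [h3, hn]; simpa using h5)⟩
  set z := a • q + T h with hzdef
  have hzj (j) : ⟪b j, z⟫_ℝ = a * ⟪b j, q⟫_ℝ + l j * ⟪b j, h⟫_ℝ := by
    rw [hzdef, inner_add_right, cT, real_inner_smul_right]
  have main : c * a ^ 2 + 2 * a * ⟪q, h⟫_ℝ + ⟪h, T h⟫_ℝ ≤ ∑ j, ⟪b j, z⟫_ℝ ^ 2 / l j := by
    have : ∑ j, ⟪b j, z⟫_ℝ ^ 2 / l j =
        a ^ 2 * ∑ j, ⟪b j, q⟫_ℝ ^ 2 / l j + 2 * a * ⟪q, h⟫_ℝ + ⟪h, T h⟫_ℝ := by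
      rw [cQ, cI q, Finset.mul_sum, Finset.mul_sum, ← Finset.sum_add_distrib,
        ← Finset.sum_add_distrib]
      refine Finset.sum_congr rfl fun j _ => ?_
      rw [hzj]
      by_cases hj : l j = 0
      · have := hz j hj
        simp [hj, this]
      · field_simp; ring
    rw [this]
    nlinarith [mul_le_mul_of_nonneg_left hc (sq_nonneg a)]
  refine (mul_le_mul_of_nonneg_left main (sq_nonneg _)).trans ?_
  by_cases hex : ∃ j, 0 < l j
  · obtain ⟨i, hi⟩ := hex
    obtain ⟨hi1, t, ht⟩ := hpos i hi
    have hle : ∑ j, ⟪b j, z⟫_ℝ ^ 2 / l j ≤ ⟪b i, z⟫_ℝ ^ 2 := by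
      rw [← Finset.add_sum_erase _ _ (Finset.mem_univ i)]
      have hA : ⟪b i, z⟫_ℝ ^ 2 / l i ≤ ⟪b i, z⟫_ℝ ^ 2 := div_le_self (sq_nonneg _) hi1
      have hB : ∑ j ∈ Finset.univ.erase i, ⟪b j, z⟫_ℝ ^ 2 / l j ≤ 0 := by
        refine Finset.sum_nonpos fun j hj => ?_
        refine div_nonpos_of_nonneg_of_nonpos (sq_nonneg _) (not_lt.1 fun hj' => ?_)
        obtain ⟨-, s, hs⟩ := hpos j hj'
        have ho : ⟪b j, b i⟫_ℝ = 0 := b.orthonormal.inner_eq_zero (Finset.ne_of_mem_erase hj)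
        have n1 : ⟪b j, b j⟫_ℝ = 1 := by rw [real_inner_self_eq_norm_sq, b.norm_eq_one]; norm_num
        have n2 : ⟪b i, b i⟫_ℝ = 1 := by rw [real_inner_self_eq_norm_sq, b.norm_eq_one]; norm_num
        rw [hs, ht, real_inner_smul_left, real_inner_smul_right] at ho
        rw [hs, real_inner_smul_left, real_inner_smul_right] at n1
        rw [ht, real_inner_smul_left, real_inner_smul_right] at n2
        have : (s * (s * ⟪e, e⟫_ℝ)) * (t * (t * ⟪e, e⟫_ℝ)) = (s * (t * ⟪e, e⟫_ℝ)) ^ 2 := by ring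
        rw [n1, n2, ho] at this
        norm_num at this
      linarith
    refine (mul_le_mul_of_nonneg_left hle (sq_nonneg _)).trans (le_of_eq ?_)
    have n2 : ⟪b i, b i⟫_ℝ = 1 := by rw [real_inner_self_eq_norm_sq, b.norm_eq_one]; norm_num
    rw [ht, real_inner_smul_left, real_inner_smul_right, real_inner_self_eq_norm_sq] at n2
    rw [ht, real_inner_smul_left, real_inner_comm e z]
    linear_combination ⟪e, z⟫_ℝ ^ 2 * n2
  · push Not at hex
    have hB : ∑ j, ⟪b j, z⟫_ℝ ^ 2 / l j ≤ 0 :=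
      Finset.sum_nonpos fun j _ => div_nonpos_of_nonneg_of_nonpos (sq_nonneg _) (hex j)
    nlinarith [sq_nonneg ‖e‖, sq_nonneg ⟪z, e⟫_ℝ]

open scoped InnerProductSpace in
/-- A Bochner-type criterion for the reverse Cauchy-Schwarz inequality of the quadratic form
`c a² + 2 a ∑ pᵢ hᵢ + ∑ Wᵢⱼ hᵢ hⱼ` at the point `a = 0`, `h = 1`. -/
lemma reverse_cauchy_of_le {ι : Type*} [Fintype ι] [DecidableEq ι] (c : ℝ) (p : ι → ℝ)
    (W : ι → ι → ℝ) (hsymm : ∀ i j, W i j = W j i) (hW : ∀ i j, 0 ≤ W i j)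
    (hp : ∀ i, ∑ j, W i j = 0 → p i = 0)
    (hle : ∀ (a : ℝ) (h : ι → ℝ),
      c * a ^ 2 + 2 * a * ∑ i, p i * h i + ∑ i, ∑ j, W i j * h i * h j ≤
        ∑ i, (a * p i + ∑ j, W i j * h j) ^ 2 / ∑ j, W i j)
    (hconn : ∀ g : ι → ℝ, (∀ i j, W i j ≠ 0 → g i = g j) →
      ∃ t, ∀ i, ∑ j, W i j ≠ 0 → g i = t) (a : ℝ) (h : ι → ℝ) :
    (∑ i, ∑ j, W i j) *
        (c * a ^ 2 + 2 * a * ∑ i, p i * h i + ∑ i, ∑ j, W i j * h i * h j) ≤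
      (∑ i, (a * p i + ∑ j, W i j * h j)) ^ 2 := by
  set m : ι → ℝ := fun i => ∑ j, W i j with hm
  have hm0 (i) : 0 ≤ m i := Finset.sum_nonneg fun j _ => hW i j
  have hWz (i j) (hi : m i = 0) : W i j = 0 :=
    (Finset.sum_eq_zero_iff_of_nonneg fun j _ => hW i j).1 hi j (Finset.mem_univ j)
  have hWz' (i j) (hj : m j = 0) : W i j = 0 := by rw [hsymm]; exact hWz j i hj
  have hsq (i) : √(m i) * √(m i) = m i := Real.mul_self_sqrt (hm0 i)
  have hs0 (i) : √(m i) = 0 ↔ m i = 0 := Real.sqrt_eq_zero (hm0 i)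
  set S : Matrix ι ι ℝ := Matrix.of fun i j => W i j / (√(m i) * √(m j)) with hS
  set T := Matrix.toEuclideanLin S with hTdef
  have hTs : T.IsSymmetric := by
    rw [hTdef, Matrix.isSymmetric_toEuclideanLin_iff]
    ext i j
    simp [hS, hsymm i j, mul_comm]
  set q : EuclideanSpace ℝ ι := WithLp.toLp 2 fun i => p i / √(m i) with hq
  set e : EuclideanSpace ℝ ι := WithLp.toLp 2 fun i => √(m i) with he
  have hTa (x : EuclideanSpace ℝ ι) (i) : T x i = (∑ j, W i j * (x j / √(m j))) / √(m i) := by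
    rw [hTdef, Matrix.toLpLin_apply]
    simp only [Matrix.mulVec, dotProduct, hS, Matrix.of_apply]
    rw [Finset.sum_div]
    exact Finset.sum_congr rfl fun j _ => by rw [div_mul_eq_mul_div, mul_comm (√(m i)),
      ← div_div, mul_div_assoc]
  have hqx (x : EuclideanSpace ℝ ι) : ⟪q, x⟫_ℝ = ∑ i, p i * (x i / √(m i)) := by
    rw [PiLp.inner_apply]
    refine Finset.sum_congr rfl fun i _ => ?_
    simp only [hq, RCLike.inner_apply, conj_trivial]
    ring
  have hxT (x : EuclideanSpace ℝ ι) :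
      ⟪x, T x⟫_ℝ = ∑ i, ∑ j, W i j * (x i / √(m i)) * (x j / √(m j)) := by
    rw [PiLp.inner_apply]
    refine Finset.sum_congr rfl fun i _ => ?_
    simp only [hTa, RCLike.inner_apply, conj_trivial]
    rw [div_mul_eq_mul_div, mul_comm _ (x i), mul_div_right_comm, Finset.mul_sum]
    exact Finset.sum_congr rfl fun j _ => by ring
  have hn (x : EuclideanSpace ℝ ι) : ‖x‖ ^ 2 = ∑ i, x i ^ 2 := by
    rw [EuclideanSpace.norm_sq_eq]; simp
  have hz (a : ℝ) (x : EuclideanSpace ℝ ι) (i) :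
      (a • q + T x) i = (a * p i + ∑ j, W i j * (x j / √(m j))) / √(m i) := by
    simp only [PiLp.add_apply, PiLp.smul_apply, smul_eq_mul, hTa, hq]
    ring
  have hen : ‖e‖ ^ 2 = ∑ i, m i := by
    rw [hn]
    exact Finset.sum_congr rfl fun i _ => by simp only [he]; rw [sq, hsq]
  have H := norm_sq_mul_le_inner_sq T hTs c q e
    (by
      intro a x
      rw [hqx, hxT, hn]
      refine (hle a fun i => x i / √(m i)).trans (le_of_eq ?_)
      refine Finset.sum_congr rfl fun i _ => ?_
      rw [hz, div_pow, sq √(m i), hsq])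
    (by
      intro x hx
      set g : ι → ℝ := fun i => x i / √(m i) with hg
      have hxg (i) (hi : m i ≠ 0) : x i = √(m i) * g i := by
        have := (hs0 i).not.2 hi
        simp only [hg]; field_simp
      have hgm (i) : m i * g i ^ 2 ≤ x i ^ 2 := by
        by_cases hi : m i = 0
        · rw [hi, zero_mul]; positivity
        · rw [hxg i hi, mul_pow, sq √(m i), hsq]
      have hdir : ∑ i, ∑ j, W i j * (g i - g j) ^ 2 =
          2 * (∑ i, m i * g i ^ 2) - 2 * ∑ i, ∑ j, W i j * g i * g j := by
        have e1 : ∑ i, m i * g i ^ 2 = ∑ i, ∑ j, W i j * g i ^ 2 :=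
          Finset.sum_congr rfl fun i _ => by rw [hm, Finset.sum_mul]
        have e2 : ∑ i, m i * g i ^ 2 = ∑ i, ∑ j, W i j * g j ^ 2 := by
          rw [e1, Finset.sum_comm]
          exact Finset.sum_congr rfl fun i _ => Finset.sum_congr rfl fun j _ => by rw [hsymm]
        have e3 : 2 * (∑ i, m i * g i ^ 2) =
            ∑ i, ∑ j, W i j * g i ^ 2 + ∑ i, ∑ j, W i j * g j ^ 2 := by rw [← e1, ← e2]; ring
        rw [e3, Finset.mul_sum, ← Finset.sum_add_distrib, ← Finset.sum_sub_distrib]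
        refine Finset.sum_congr rfl fun i _ => ?_
        rw [Finset.mul_sum, ← Finset.sum_add_distrib, ← Finset.sum_sub_distrib]
        exact Finset.sum_congr rfl fun j _ => by ring
      rw [hn, hxT] at hx
      have hsum : ∑ i, m i * g i ^ 2 ≤ ∑ i, x i ^ 2 := Finset.sum_le_sum fun i _ => hgm i
      have hterm (i j) : 0 ≤ W i j * (g i - g j) ^ 2 := mul_nonneg (hW i j) (sq_nonneg _)
      have hrow (i) : 0 ≤ ∑ j, W i j * (g i - g j) ^ 2 := Finset.sum_nonneg fun j _ => hterm i j
      have hd0 : ∑ i, ∑ j, W i j * (g i - g j) ^ 2 = 0 :=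
        le_antisymm (by rw [hdir]; linarith) (Finset.sum_nonneg fun i _ => hrow i)
      have heq : ∑ i, m i * g i ^ 2 = ∑ i, x i ^ 2 := by rw [hd0] at hdir; linarith
      obtain ⟨t, ht⟩ := hconn g (by
        intro i j hij
        have h1 := (Finset.sum_eq_zero_iff_of_nonneg fun i _ => hrow i).1 hd0 i (Finset.mem_univ i)
        have h2 := (Finset.sum_eq_zero_iff_of_nonneg fun j _ => hterm i j).1 h1 j
          (Finset.mem_univ j)
        rcases mul_eq_zero.1 h2 with h2 | h2
        · exact absurd h2 hij
        · exact sub_eq_zero.1 (pow_eq_zero_iff two_ne_zero |>.1 h2))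
      refine ⟨t, ?_⟩
      ext i
      by_cases hi : m i = 0
      · have := (Finset.sum_eq_sum_iff_of_le fun i _ => hgm i).1 heq i (Finset.mem_univ i)
        rw [hi, zero_mul] at this
        have h0 : x i = 0 := pow_eq_zero_iff two_ne_zero |>.1 this.symm
        simp [h0, he, hi]
      · rw [hxg i hi, ht i hi]
        simp [he, mul_comm])
    a (WithLp.toLp 2 fun i => √(m i) * h i)
  have hcancel (i) (hi : m i ≠ 0) : √(m i) * h i / √(m i) = h i :=
    mul_div_cancel_left₀ _ ((hs0 i).not.2 hi)
  have r1 : ∑ i, p i * (√(m i) * h i / √(m i)) = ∑ i, p i * h i := by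
    refine Finset.sum_congr rfl fun i _ => ?_
    by_cases hi : m i = 0
    · simp [hp i hi]
    · rw [hcancel i hi]
  have r2 (i) : ∑ j, W i j * (√(m j) * h j / √(m j)) = ∑ j, W i j * h j := by
    refine Finset.sum_congr rfl fun j _ => ?_
    by_cases hj : m j = 0
    · simp [hWz' i j hj]
    · rw [hcancel j hj]
  have r3 : ∑ i, ∑ j, W i j * (√(m i) * h i / √(m i)) * (√(m j) * h j / √(m j)) =
      ∑ i, ∑ j, W i j * h i * h j := by
    refine Finset.sum_congr rfl fun i _ => Finset.sum_congr rfl fun j _ => ?_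
    by_cases hi : m i = 0
    · simp [hWz i j hi]
    by_cases hj : m j = 0
    · simp [hWz' i j hj]
    · rw [hcancel i hi, hcancel j hj]
  rw [hen, hqx, hxT] at H
  simp only [r1, r3] at H
  refine H.trans (le_of_eq ?_)
  congr 1
  rw [PiLp.inner_apply]
  refine Finset.sum_congr rfl fun i _ => ?_
  rw [hz]
  simp only [RCLike.inner_apply, conj_trivial, he, r2]
  by_cases hi : m i = 0
  · have : ∑ j, W i j * h j = 0 := Finset.sum_eq_zero fun j _ => by rw [hWz i j hi, zero_mul]
    simp [hi, hp i hi, this]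
  · have := (hs0 i).not.2 hi
    field_simp

lemma PaperMatroid.exists_superset {n : ℕ} (M : PaperMatroid n) {J K : Finset (Fin n)}
    (hJ : M.Indep J) (hK : M.Indep K) (h : J.card ≤ K.card) :
    ∃ L, J ⊆ L ∧ M.Indep L ∧ L.card = K.card := by
  obtain ⟨d, hd⟩ := Nat.exists_eq_add_of_le h
  induction d generalizing J with
  | zero => exact ⟨J, subset_rfl, hJ, by omega⟩
  | succ d ih =>
    obtain ⟨i, hi, hiJ⟩ := M.indep_exchange hJ hK (by omega)
    have hc := Finset.card_insert_of_notMem (Finset.mem_sdiff.1 hi).2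
    obtain ⟨L, hL, h1, h2⟩ := ih hiJ (by omega) (by omega)
    exact ⟨L, (Finset.subset_insert i J).trans hL, h1, h2⟩

/-- In the contraction by `J`, an element `j` cannot be parallel to two nonparallel elements. -/
lemma PaperMatroid.indep_or_indep {n : ℕ} (M : PaperMatroid n) {J : Finset (Fin n)} {i j k : Fin n}
    (hi : i ∉ J) (hk : k ∉ insert i J) (h : M.Indep (insert k (insert i J))) (hj : j ∉ J)
    (hjJ : M.Indep (insert j J)) :
    (j ∉ insert i J ∧ M.Indep (insert j (insert i J))) ∨
      (k ∉ insert j J ∧ M.Indep (insert k (insert j J))) := by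
  obtain ⟨x, hx, hxI⟩ := M.indep_exchange hjJ h (by
    rw [Finset.card_insert_of_notMem hk, Finset.card_insert_of_notMem hi,
      Finset.card_insert_of_notMem hj]
    omega)
  rw [Finset.mem_sdiff, Finset.mem_insert, Finset.mem_insert] at hx
  obtain ⟨rfl | rfl | hx, hx'⟩ := hx
  · exact Or.inr ⟨hx', hxI⟩
  · refine Or.inl ⟨fun hmem => ?_, by rwa [Finset.insert_comm]⟩
    rcases Finset.mem_insert.1 hmem with rfl | h
    · exact hx' (Finset.mem_insert_self _ _)
    · exact hj h
  · exact absurd (Finset.mem_insert_of_mem hx) hx'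

open Classical in
/-- The number of independent sets of cardinality `t` containing `J`. -/
noncomputable def numIndepAbove {n : ℕ} (M : PaperMatroid n) (t : ℕ) (J : Finset (Fin n)) : ℝ :=
  ∑ K ∈ Finset.univ.filter (fun K => M.Indep K ∧ K.card = t), if J ⊆ K then 1 else 0

/-- The values of a set function at the sets obtained by adding one new element. -/
def adjoin {n : ℕ} (F : Finset (Fin n) → ℝ) (J : Finset (Fin n)) (i : Fin n) : ℝ :=
  if i ∈ J then 0 else F (insert i J)

/-- The values of a set function at the sets obtained by adding two new elements. -/
def adjoinTwo {n : ℕ} (F : Finset (Fin n) → ℝ) (J : Finset (Fin n)) (i j : Fin n) : ℝ :=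
  if i ∈ J then 0 else adjoin F (insert i J) j

/-- The values of a set function at the sets obtained by adding three new elements. -/
def adjoinThree {n : ℕ} (F : Finset (Fin n) → ℝ) (J : Finset (Fin n)) (i j k : Fin n) : ℝ :=
  if i ∈ J then 0 else adjoinTwo F (insert i J) j k

lemma adjoinTwo_comm {n : ℕ} (F : Finset (Fin n) → ℝ) (J : Finset (Fin n)) (i j : Fin n) :
    adjoinTwo F J i j = adjoinTwo F J j i := by
  unfold adjoinTwo adjoin
  by_cases hi : i ∈ J <;> by_cases hj : j ∈ J <;> by_cases hij : i = j <;>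
    simp [hi, hj, hij, Ne.symm, Finset.insert_comm i j]

lemma adjoinThree_comm_right {n : ℕ} (F : Finset (Fin n) → ℝ) (J : Finset (Fin n))
    (i j k : Fin n) : adjoinThree F J i j k = adjoinThree F J i k j := by
  unfold adjoinThree
  rw [adjoinTwo_comm]

lemma adjoinThree_comm_left {n : ℕ} (F : Finset (Fin n) → ℝ) (J : Finset (Fin n))
    (i j k : Fin n) : adjoinThree F J i j k = adjoinThree F J j i k := by
  have h (i j) : adjoinThree F J i j k = adjoinTwo (fun K => adjoin F K k) J i j := rfl
  rw [h, h, adjoinTwo_comm]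

section

variable {n : ℕ} (M : PaperMatroid n)

lemma numIndepAbove_nonneg (t : ℕ) (J : Finset (Fin n)) : 0 ≤ numIndepAbove M t J :=
  Finset.sum_nonneg fun K _ => by split_ifs <;> norm_num

lemma numIndepAbove_pos_iff (t : ℕ) (J : Finset (Fin n)) :
    0 < numIndepAbove M t J ↔ ∃ K, J ⊆ K ∧ M.Indep K ∧ K.card = t := by
  classical
  unfold numIndepAbove
  rw [Finset.sum_pos_iff_of_nonneg fun K _ => by split_ifs <;> norm_num]
  constructor
  · rintro ⟨K, hK, hpos⟩
    refine ⟨K, ?_, (Finset.mem_filter.1 hK).2⟩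
    by_contra h
    simp [h] at hpos
  · rintro ⟨K, hJK, hK⟩
    exact ⟨K, Finset.mem_filter.2 ⟨Finset.mem_univ _, hK⟩, by simp [hJK]⟩

lemma numIndepAbove_ne_zero_iff (t : ℕ) (J : Finset (Fin n)) :
    numIndepAbove M t J ≠ 0 ↔ ∃ K, J ⊆ K ∧ M.Indep K ∧ K.card = t := by
  rw [← numIndepAbove_pos_iff, (numIndepAbove_nonneg M t J).lt_iff_ne']

lemma numIndepAbove_eq_zero (t : ℕ) {J : Finset (Fin n)} (hJ : ¬ M.Indep J) :
    numIndepAbove M t J = 0 := by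
  by_contra h
  obtain ⟨K, hJK, hK, -⟩ := (numIndepAbove_ne_zero_iff M t J).1 h
  exact hJ (M.indep_subset hJK hK)

lemma numIndepAbove_ne_zero {t : ℕ} {J J' : Finset (Fin n)} (h : numIndepAbove M t J' ≠ 0)
    (hJ : M.Indep J) (hJt : J.card ≤ t) : numIndepAbove M t J ≠ 0 := by
  obtain ⟨K, -, hK, rfl⟩ := (numIndepAbove_ne_zero_iff M t J').1 h
  exact (numIndepAbove_ne_zero_iff M _ J).2 (M.exists_superset hJ hK hJt)

lemma numIndepAbove_card {J : Finset (Fin n)} (hJ : M.Indep J) :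
    numIndepAbove M J.card J = 1 := by
  classical
  unfold numIndepAbove
  rw [Finset.sum_eq_single J]
  · simp
  · intro K hK hne
    rw [if_neg fun h => hne (Finset.eq_of_subset_of_card_le h (Finset.mem_filter.1 hK).2.2.le).symm]
  · intro h
    exact absurd (Finset.mem_filter.2 ⟨Finset.mem_univ _, hJ, rfl⟩) h

lemma sum_adjoin (t : ℕ) (J : Finset (Fin n)) :
    ∑ i, adjoin (numIndepAbove M t) J i = ((t : ℝ) - J.card) * numIndepAbove M t J := by
  classical
  have e (i) : adjoin (numIndepAbove M t) J i =
      ∑ K ∈ Finset.univ.filter (fun K => M.Indep K ∧ K.card = t),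
        if J ⊆ K ∧ i ∈ K \ J then (1 : ℝ) else 0 := by
    unfold adjoin numIndepAbove
    split_ifs with h
    · simp [h]
    · refine Finset.sum_congr rfl fun K _ => ?_
      simp [Finset.insert_subset_iff, h, and_comm]
  simp only [e]
  rw [Finset.sum_comm, numIndepAbove, Finset.mul_sum]
  refine Finset.sum_congr rfl fun K hK => ?_
  by_cases h : J ⊆ K
  · have hc := Finset.card_sdiff_add_card_eq_card h
    rw [(Finset.mem_filter.1 hK).2.2] at hc
    simp only [h, true_and, if_true, mul_one]
    rw [Finset.sum_ite_mem, Finset.univ_inter, Finset.sum_const, nsmul_eq_mul, mul_one, ← hc]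
    push_cast
    ring
  · simp [h]

lemma sum_adjoinTwo (t : ℕ) (J : Finset (Fin n)) (i : Fin n) :
    ∑ j, adjoinTwo (numIndepAbove M t) J i j =
      ((t : ℝ) - J.card - 1) * adjoin (numIndepAbove M t) J i := by
  by_cases hi : i ∈ J
  · simp [adjoinTwo, adjoin, hi]
  · have : ∑ j, adjoinTwo (numIndepAbove M t) J i j =
        ∑ j, adjoin (numIndepAbove M t) (insert i J) j :=
      Finset.sum_congr rfl fun j _ => by simp [adjoinTwo, hi]
    rw [this, sum_adjoin, Finset.card_insert_of_notMem hi, adjoin, if_neg hi]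
    push_cast
    ring

lemma sum_adjoinThree (t : ℕ) (J : Finset (Fin n)) (i j : Fin n) :
    ∑ k, adjoinThree (numIndepAbove M t) J i j k =
      ((t : ℝ) - J.card - 2) * adjoinTwo (numIndepAbove M t) J i j := by
  by_cases hi : i ∈ J
  · simp [adjoinThree, adjoinTwo, hi]
  · have : ∑ k, adjoinThree (numIndepAbove M t) J i j k =
        ∑ k, adjoinTwo (numIndepAbove M t) (insert i J) j k :=
      Finset.sum_congr rfl fun k _ => by simp [adjoinThree, hi]
    rw [this, sum_adjoinTwo, Finset.card_insert_of_notMem hi, adjoinTwo, if_neg hi]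
    push_cast
    ring

lemma adjoin_nonneg (t : ℕ) (J : Finset (Fin n)) (i : Fin n) :
    0 ≤ adjoin (numIndepAbove M t) J i := by
  unfold adjoin
  split_ifs
  exacts [le_rfl, numIndepAbove_nonneg M _ _]

lemma adjoinTwo_nonneg (t : ℕ) (J : Finset (Fin n)) (i j : Fin n) :
    0 ≤ adjoinTwo (numIndepAbove M t) J i j := by
  unfold adjoinTwo
  split_ifs
  exacts [le_rfl, adjoin_nonneg M _ _ _]

lemma adjoinTwo_ne_zero_iff {t : ℕ} {J : Finset (Fin n)} (h0 : numIndepAbove M t J ≠ 0)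
    (hJ : J.card + 2 ≤ t) (i j : Fin n) : adjoinTwo (numIndepAbove M t) J i j ≠ 0 ↔
      i ∉ J ∧ j ∉ insert i J ∧ M.Indep (insert j (insert i J)) := by
  unfold adjoinTwo adjoin
  by_cases hi : i ∈ J
  · simp [hi]
  by_cases hj : j ∈ insert i J
  · simp [hj]
  simp only [hi, hj, if_false, not_false_eq_true, true_and]
  refine ⟨fun h => by_contra fun hn => h (numIndepAbove_eq_zero M t hn), fun h =>
    numIndepAbove_ne_zero M h0 h ?_⟩
  rw [Finset.card_insert_of_notMem hj, Finset.card_insert_of_notMem hi]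
  omega

/-- If no pair of `i` and `k` vanishes, then every non-loop `j` pairs with `i` or with `k`. -/
lemma adjoinTwo_ne_zero_or {t : ℕ} {J : Finset (Fin n)} (h0 : numIndepAbove M t J ≠ 0)
    (hJ : J.card + 2 ≤ t) {i j k : Fin n} (h : adjoinTwo (numIndepAbove M t) J i k ≠ 0)
    (hj : j ∉ J) (hjJ : M.Indep (insert j J)) :
    adjoinTwo (numIndepAbove M t) J i j ≠ 0 ∨ adjoinTwo (numIndepAbove M t) J j k ≠ 0 := by
  rw [adjoinTwo_ne_zero_iff M h0 hJ] at h ⊢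
  rw [adjoinTwo_ne_zero_iff M h0 hJ]
  obtain ⟨h1, h2, h3⟩ := h
  exact (M.indep_or_indep h1 h2 h3 hj hjJ).imp (fun h => ⟨h1, h⟩) fun h => ⟨hj, h⟩

lemma indep_insert_of_adjoin_ne_zero {t : ℕ} {J : Finset (Fin n)} {i : Fin n}
    (h : adjoin (numIndepAbove M t) J i ≠ 0) : i ∉ J ∧ M.Indep (insert i J) := by
  unfold adjoin at h
  split_ifs at h with hi
  · exact absurd rfl h
  · exact ⟨hi, by_contra fun hn => h (numIndepAbove_eq_zero M t hn)⟩

lemma adjoin_ne_zero {t : ℕ} {J : Finset (Fin n)} (h0 : numIndepAbove M t J ≠ 0)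
    (hJ : J.card + 1 ≤ t) {i : Fin n} (hi : i ∉ J) (hiJ : M.Indep (insert i J)) :
    adjoin (numIndepAbove M t) J i ≠ 0 := by
  rw [adjoin, if_neg hi]
  refine numIndepAbove_ne_zero M h0 hiJ ?_
  rwa [Finset.card_insert_of_notMem hi]

end

lemma sq_sum_le_card_mul_sum_fiber {ι κ : Type*} [DecidableEq κ] (N : Finset ι) (f : ι → κ)
    (h : ι → ℝ) : (∑ i ∈ N, h i) ^ 2 ≤
      N.card * ∑ i ∈ N, ∑ j ∈ N, if f i = f j then h i * h j else 0 := by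
  have e1 : ∑ i ∈ N, h i = ∑ c ∈ N.image f, ∑ i ∈ N with f i = c, h i :=
    (Finset.sum_fiberwise_of_maps_to (fun i hi => Finset.mem_image_of_mem f hi) h).symm
  have e2 : ∑ i ∈ N, ∑ j ∈ N, (if f i = f j then h i * h j else 0) =
      ∑ c ∈ N.image f, (∑ i ∈ N with f i = c, h i) ^ 2 := by
    rw [← Finset.sum_fiberwise_of_maps_to (fun i hi => Finset.mem_image_of_mem f hi)]
    refine Finset.sum_congr rfl fun c _ => ?_
    rw [sq, Finset.sum_mul]
    refine Finset.sum_congr rfl fun i hi => ?_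
    rw [Finset.mul_sum, Finset.sum_filter, (Finset.mem_filter.1 hi).2]
    exact Finset.sum_congr rfl fun j _ => by simp only [eq_comm]
  rw [e1, e2]
  refine sq_sum_le_card_mul_sum_sq.trans ?_
  refine mul_le_mul_of_nonneg_right ?_ (Finset.sum_nonneg fun _ _ => sq_nonneg _)
  exact_mod_cast Finset.card_image_le

section

variable {n : ℕ} (M : PaperMatroid n)

lemma adjoinTwo_eq_one_of_ne_zero {J : Finset (Fin n)} {i j : Fin n}
    (h : adjoinTwo (numIndepAbove M (J.card + 2)) J i j ≠ 0) :
    adjoinTwo (numIndepAbove M (J.card + 2)) J i j = 1 := by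
  unfold adjoinTwo adjoin at *
  split_ifs at * with h1 h2
  · exact absurd rfl h
  · exact absurd rfl h
  · have hI : M.Indep (insert j (insert i J)) :=
      by_contra fun hn => h (numIndepAbove_eq_zero M _ hn)
    rw [← numIndepAbove_card M hI, Finset.card_insert_of_notMem h2, Finset.card_insert_of_notMem h1]

/-- A bound for the quadratic form counting the independent pairs of the contraction by `J`,
truncated to rank two, in terms of the set `N` of its non-loops. -/
lemma sum_adjoinTwo_mul_le {J : Finset (Fin n)}
    (h0 : numIndepAbove M (J.card + 2) J ≠ 0) (N : Finset (Fin n))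
    (hN : ∀ i, i ∈ N ↔ i ∉ J ∧ M.Indep (insert i J)) (h : Fin n → ℝ) :
    N.card * ∑ i, ∑ j, adjoinTwo (numIndepAbove M (J.card + 2)) J i j * h i * h j ≤
      (N.card - 1) * (∑ i ∈ N, h i) ^ 2 := by
  classical
  set W := adjoinTwo (numIndepAbove M (J.card + 2)) J with hW
  have hWs (i j) : W i j = W j i := adjoinTwo_comm _ _ _ _
  have hmem {i j} (hij : W i j ≠ 0) : i ∈ N := by
    obtain ⟨h1, -, h3⟩ := (adjoinTwo_ne_zero_iff M h0 le_rfl i j).1 hij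
    exact (hN i).2 ⟨h1, M.indep_subset (Finset.subset_insert _ _) h3⟩
  have hor {i j k} (hj : j ∈ N) (hik : W i k ≠ 0) : W i j ≠ 0 ∨ W j k ≠ 0 :=
    adjoinTwo_ne_zero_or M h0 le_rfl hik ((hN j).1 hj).1 ((hN j).1 hj).2
  set f : Fin n → Finset (Fin n) := fun i => N.filter fun j => W i j = 0 with hf
  have hself (i) : W i i = 0 := by
    by_contra hi
    exact ((adjoinTwo_ne_zero_iff M h0 le_rfl i i).1 hi).2.1 (Finset.mem_insert_self _ _)
  have hWf (i) (hi : i ∈ N) (j) (hj : j ∈ N) : W i j = 1 - if f i = f j then 1 else 0 := by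
    by_cases hij : W i j = 0
    · have : f i = f j := by
        ext k
        simp only [hf, Finset.mem_filter]
        refine and_congr_right fun hk => not_iff_not.1 ⟨fun hik => ?_, fun hjk => ?_⟩
        · exact (hor hj hik).resolve_left fun h => h hij
        · exact (hor hi hjk).resolve_left fun h => h (by rwa [hWs])
      rw [hij, if_pos this, sub_self]
    · have : f i ≠ f j := by
        intro he
        have : j ∈ f j := Finset.mem_filter.2 ⟨hj, hself j⟩
        rw [← he] at this
        exact hij (Finset.mem_filter.1 this).2
      rw [if_neg this, sub_zero]
      exact adjoinTwo_eq_one_of_ne_zero M hij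
  have hsum : ∑ i, ∑ j, W i j * h i * h j = ∑ i ∈ N, ∑ j ∈ N, W i j * h i * h j := by
    have e (i) : ∑ j ∈ N, W i j * h i * h j = ∑ j, W i j * h i * h j := by
      refine Finset.sum_subset (Finset.subset_univ _) fun j _ hj => ?_
      have : W i j = 0 := by
        by_contra hij
        exact hj (hmem (by rwa [hWs]))
      simp [this]
    simp only [e]
    refine (Finset.sum_subset (Finset.subset_univ _) fun i _ hi => ?_).symm
    refine Finset.sum_eq_zero fun j _ => ?_
    have : W i j = 0 := by
      by_contra hij
      exact hi (hmem hij)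
    simp [this]
  have hsum2 : ∑ i ∈ N, ∑ j ∈ N, W i j * h i * h j =
      (∑ i ∈ N, h i) ^ 2 - ∑ i ∈ N, ∑ j ∈ N, if f i = f j then h i * h j else 0 := by
    rw [sq, Finset.sum_mul_sum, ← Finset.sum_sub_distrib]
    refine Finset.sum_congr rfl fun i hi => ?_
    rw [← Finset.sum_sub_distrib]
    refine Finset.sum_congr rfl fun j hj => ?_
    rw [hWf i hi j hj]
    split_ifs <;> ring
  have := sq_sum_le_card_mul_sum_fiber N f h
  rw [hsum, hsum2]
  linarith

/-- The rank-two case of `reverse_cauchy_adjoin`. -/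
lemma reverse_cauchy_adjoin_of_card_eq (J : Finset (Fin n)) (hn : J.card + 2 ≤ n) (a : ℝ)
    (h : Fin n → ℝ) :
    (∑ i, ∑ j, adjoinTwo (numIndepAbove M (J.card + 2)) J i j) *
        (((n : ℝ) - (J.card + 1)) * ((n : ℝ) - J.card) * numIndepAbove M J.card J * a ^ 2 +
          2 * a * ∑ i, ((n : ℝ) - (J.card + 1)) * adjoin (numIndepAbove M (J.card + 1)) J i * h i +
          ∑ i, ∑ j, adjoinTwo (numIndepAbove M (J.card + 2)) J i j * h i * h j) ≤
      (∑ i, (a * (((n : ℝ) - (J.card + 1)) * adjoin (numIndepAbove M (J.card + 1)) J i) +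
        ∑ j, adjoinTwo (numIndepAbove M (J.card + 2)) J i j * h j)) ^ 2 := by
  classical
  by_cases h0 : numIndepAbove M (J.card + 2) J = 0
  · simp only [sum_adjoinTwo, ← Finset.mul_sum, sum_adjoin, h0, mul_zero, zero_mul]
    exact sq_nonneg _
  have hJ : M.Indep J := by_contra fun hn => h0 (numIndepAbove_eq_zero M _ hn)
  set N := Finset.univ.filter fun i => i ∉ J ∧ M.Indep (insert i J) with hNdef
  have hN (i) : i ∈ N ↔ i ∉ J ∧ M.Indep (insert i J) := by simp [hNdef]
  have hp (i) : adjoin (numIndepAbove M (J.card + 1)) J i = if i ∈ N then 1 else 0 := by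
    split_ifs with hi
    · obtain ⟨h1, h2⟩ := (hN i).1 hi
      rw [adjoin, if_neg h1, ← numIndepAbove_card M h2, Finset.card_insert_of_notMem h1]
    · by_contra hne
      exact hi ((hN i).2 (indep_insert_of_adjoin_ne_zero M hne))
  have hNcard : (N.card : ℝ) ≤ (n : ℝ) - J.card := by
    have h1 : N.card ≤ Jᶜ.card := Finset.card_le_card fun i hi =>
      Finset.mem_compl.2 ((hN i).1 hi).1
    have h2 := Finset.card_add_card_compl J
    rw [Fintype.card_fin] at h2
    have : (J.card : ℝ) + Jᶜ.card = n := by exact_mod_cast h2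
    have : (N.card : ℝ) ≤ Jᶜ.card := by exact_mod_cast h1
    linarith
  have hNpos : 0 < (N.card : ℝ) := by
    obtain ⟨K, hJK, hK, hKc⟩ := (numIndepAbove_ne_zero_iff M _ J).1 h0
    obtain ⟨i, hi, hiJ⟩ := M.indep_exchange hJ hK (by omega)
    have : i ∈ N := (hN i).2 ⟨(Finset.mem_sdiff.1 hi).2, hiJ⟩
    exact_mod_cast Finset.card_pos.2 ⟨i, this⟩
  set W := adjoinTwo (numIndepAbove M (J.card + 2)) J with hW
  have hWs (i j) : W i j = W j i := adjoinTwo_comm _ _ _ _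
  set b : ℝ := (n : ℝ) - (J.card + 1) with hb
  have hb1 : 1 ≤ b := by
    have : (J.card : ℝ) + 2 ≤ n := by exact_mod_cast hn
    linarith
  have hb2 : (n : ℝ) - J.card = b + 1 := by rw [hb]; ring
  rw [hb2] at hNcard ⊢
  rw [numIndepAbove_card M hJ]
  have hs1 (h : Fin n → ℝ) : ∑ i, b * adjoin (numIndepAbove M (J.card + 1)) J i * h i =
      b * ∑ i ∈ N, h i := by
    simp only [hp, mul_assoc, ← Finset.mul_sum]
    simp
  have hs2 : ∑ i, (a * (b * adjoin (numIndepAbove M (J.card + 1)) J i) + ∑ j, W i j * h j) =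
      a * b * N.card + ∑ i, ∑ j, W i j * h j := by
    rw [Finset.sum_add_distrib]
    simp only [hp, ← mul_assoc, ← Finset.mul_sum]
    simp
  rw [hs1, hs2]
  have hneg (g : Fin n → ℝ) :
      (b + 1) * ∑ i, ∑ j, W i j * g i * g j ≤ b * (∑ i ∈ N, g i) ^ 2 := by
    have h1 := sum_adjoinTwo_mul_le M h0 N hN g
    rw [← hW] at h1
    refine le_of_mul_le_mul_left ?_ hNpos
    nlinarith [mul_nonneg (sub_nonneg.2 hNcard) (sq_nonneg (∑ i ∈ N, g i))]
  set H := ∑ i ∈ N, h i with hH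
  set q := ∑ i, ∑ j, W i j with hq
  set B := ∑ i, ∑ j, W i j * h j with hB
  set R := ∑ i, ∑ j, W i j * h i * h j with hR
  have hB' : ∑ i, ∑ j, W i j * h i = B := by
    rw [hB, Finset.sum_comm]
    exact Finset.sum_congr rfl fun i _ => Finset.sum_congr rfl fun j _ => by rw [hWs]
  set A : ℝ := a * (b + 1) + H with hA
  have hspec := hneg fun i => N.card * h i - A
  have e1 : ∑ i ∈ N, (N.card * h i - A) = N.card * (H - A) := by
    rw [Finset.sum_sub_distrib, ← Finset.mul_sum, Finset.sum_const, nsmul_eq_mul]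
    ring
  have e2 : ∑ i, ∑ j, W i j * (N.card * h i - A) * (N.card * h j - A) =
      (N.card : ℝ) ^ 2 * R - N.card * A * B - N.card * A * B + A ^ 2 * q := by
    nth_rewrite 1 [← hB']
    rw [hR, hB, hq]
    simp only [Finset.mul_sum, ← Finset.sum_sub_distrib, ← Finset.sum_add_distrib]
    exact Finset.sum_congr rfl fun i _ => Finset.sum_congr rfl fun j _ => by ring
  rw [e1, e2] at hspec
  have hq0 : 0 ≤ q := Finset.sum_nonneg fun i _ => Finset.sum_nonneg fun j _ =>
    adjoinTwo_nonneg M _ _ _ _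
  have hu : (N.card : ℝ) ^ 2 * (b * (b + 1) * 1 * a ^ 2 + 2 * a * (b * H) + R) -
      2 * N.card * A * (a * b * N.card + B) + A ^ 2 * q ≤ 0 := by
    have hbp : 0 < b + 1 := by linarith
    refine nonpos_of_mul_nonpos_right ?_ hbp
    rw [hA] at hspec ⊢
    nlinarith [hspec]
  have hmul := mul_le_mul_of_nonneg_left hu hq0
  refine le_of_mul_le_mul_left ?_ (pow_pos hNpos 2)
  nlinarith [sq_nonneg (A * q - N.card * (a * b * N.card + B))]

/-- The reverse Cauchy-Schwarz inequality for the Hessian of the homogenized generating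
polynomial of the independent sets containing `J`. -/
lemma reverse_cauchy_adjoin (r : ℕ) (hr : r + 2 ≤ n) (d : ℕ) (J : Finset (Fin n))
    (hJd : J.card + d = r) (a : ℝ) (h : Fin n → ℝ) :
    (∑ i, ∑ j, adjoinTwo (numIndepAbove M (r + 2)) J i j) *
        (((n : ℝ) - (r + 1)) * ((n : ℝ) - r) * numIndepAbove M r J * a ^ 2 +
          2 * a * ∑ i, ((n : ℝ) - (r + 1)) * adjoin (numIndepAbove M (r + 1)) J i * h i +
          ∑ i, ∑ j, adjoinTwo (numIndepAbove M (r + 2)) J i j * h i * h j) ≤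
      (∑ i, (a * (((n : ℝ) - (r + 1)) * adjoin (numIndepAbove M (r + 1)) J i) +
        ∑ j, adjoinTwo (numIndepAbove M (r + 2)) J i j * h j)) ^ 2 := by
  induction d generalizing J a h with
  | zero =>
    obtain rfl : J.card = r := by omega
    exact reverse_cauchy_adjoin_of_card_eq M J hr a h
  | succ d ih =>
    have hrJ : (r : ℝ) - J.card = d + 1 := by rw [← hJd]; push_cast; ring
    have hsum2 (i) : ∑ j, adjoinTwo (numIndepAbove M (r + 2)) J i j =
        ((d : ℝ) + 2) * adjoin (numIndepAbove M (r + 2)) J i := by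
      rw [sum_adjoinTwo]; push_cast; rw [← sub_eq_zero]
      linear_combination adjoin (numIndepAbove M (r + 2)) J i * hrJ
    by_cases h0 : numIndepAbove M (r + 2) J = 0
    · simp only [hsum2, ← Finset.mul_sum, sum_adjoin, h0, mul_zero, zero_mul]
      exact sq_nonneg _
    have hd2 : (0 : ℝ) < (d : ℝ) + 2 := by positivity
    have hd1 : (0 : ℝ) < (d : ℝ) + 1 := by positivity
    set b : ℝ := (n : ℝ) - (r + 1) with hb
    set b' : ℝ := (n : ℝ) - r with hb'
    have hrow (i) : ∑ j, adjoinTwo (numIndepAbove M (r + 2)) J i j ≠ 0 ↔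
        i ∉ J ∧ M.Indep (insert i J) := by
      rw [hsum2, mul_ne_zero_iff]
      exact ⟨fun h => indep_insert_of_adjoin_ne_zero M h.2, fun h =>
        ⟨hd2.ne', adjoin_ne_zero M h0 (by omega) h.1 h.2⟩⟩
    refine reverse_cauchy_of_le (b * b' * numIndepAbove M r J)
      (fun i => b * adjoin (numIndepAbove M (r + 1)) J i)
      (adjoinTwo (numIndepAbove M (r + 2)) J) (adjoinTwo_comm _ _)
      (adjoinTwo_nonneg M _ _) ?_ ?_ ?_ a h
    · intro i hi
      have : adjoin (numIndepAbove M (r + 1)) J i = 0 := by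
        by_contra hne
        exact (hrow i).2 (indep_insert_of_adjoin_ne_zero M hne) hi
      rw [this, mul_zero]
    · intro a h
      have hterm (i) : (if i ∈ J then 0 else
          b * b' * numIndepAbove M r (insert i J) * a ^ 2 +
          2 * a * ∑ j, b * adjoin (numIndepAbove M (r + 1)) (insert i J) j * h j +
          ∑ j, ∑ k, adjoinTwo (numIndepAbove M (r + 2)) (insert i J) j k * h j * h k) ≤
          ((d : ℝ) + 1) * ((a * (b * adjoin (numIndepAbove M (r + 1)) J i) +
            ∑ j, adjoinTwo (numIndepAbove M (r + 2)) J i j * h j) ^ 2 /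
            ∑ j, adjoinTwo (numIndepAbove M (r + 2)) J i j) := by
        have hm0 : 0 ≤ ∑ j, adjoinTwo (numIndepAbove M (r + 2)) J i j :=
          Finset.sum_nonneg fun j _ => adjoinTwo_nonneg M _ _ _ _
        split_ifs with hiJ
        · positivity
        by_cases hI : M.Indep (insert i J)
        · have hm : 0 < ∑ j, adjoinTwo (numIndepAbove M (r + 2)) J i j :=
            hm0.lt_of_ne' ((hrow i).2 ⟨hiJ, hI⟩)
          have hcard := Finset.card_insert_of_notMem hiJ
          have IH := ih (insert i J) (by omega) a h
          have hW3 (j k) : adjoinTwo (numIndepAbove M (r + 2)) (insert i J) j k =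
              adjoinThree (numIndepAbove M (r + 2)) J i j k := by rw [adjoinThree, if_neg hiJ]
          have hs3 (j) : ∑ k, adjoinTwo (numIndepAbove M (r + 2)) (insert i J) j k =
              ((d : ℝ) + 1) * adjoinTwo (numIndepAbove M (r + 2)) J i j := by
            simp only [hW3]
            rw [sum_adjoinThree]; push_cast
            linear_combination adjoinTwo (numIndepAbove M (r + 2)) J i j * hrJ
          have hs1 : ∑ j, adjoin (numIndepAbove M (r + 1)) (insert i J) j =
              ((d : ℝ) + 1) * adjoin (numIndepAbove M (r + 1)) J i := by
            rw [sum_adjoin, hcard, adjoin, if_neg hiJ]; push_cast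
            linear_combination numIndepAbove M (r + 1) (insert i J) * hrJ
          have hX : ∑ j, (a * (b * adjoin (numIndepAbove M (r + 1)) (insert i J) j) +
              ∑ k, adjoinTwo (numIndepAbove M (r + 2)) (insert i J) j k * h k) =
              ((d : ℝ) + 1) * (a * (b * adjoin (numIndepAbove M (r + 1)) J i) +
                ∑ j, adjoinTwo (numIndepAbove M (r + 2)) J i j * h j) := by
            rw [Finset.sum_add_distrib, Finset.sum_comm, ← Finset.mul_sum, ← Finset.mul_sum, hs1]
            have : ∑ k, ∑ j, adjoinTwo (numIndepAbove M (r + 2)) (insert i J) j k * h k =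
                ((d : ℝ) + 1) * ∑ k, adjoinTwo (numIndepAbove M (r + 2)) J i k * h k := by
              rw [Finset.mul_sum]
              refine Finset.sum_congr rfl fun k _ => ?_
              rw [← Finset.sum_mul, ← mul_assoc, ← hs3]
              simp only [adjoinTwo_comm]
            rw [this]; ring
          rw [hX] at IH
          simp only [hs3] at IH
          rw [← Finset.mul_sum] at IH
          rw [← mul_div_assoc, le_div_iff₀ hm]
          refine le_of_mul_le_mul_left ?_ hd1
          refine le_trans (le_of_eq ?_) (IH.trans (le_of_eq ?_)) <;> ring
        · have z0 := numIndepAbove_eq_zero M r hI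
          have z1 (j) : adjoin (numIndepAbove M (r + 1)) (insert i J) j = 0 := by
            by_contra hne
            exact hI (M.indep_subset (Finset.subset_insert _ _)
              (indep_insert_of_adjoin_ne_zero M hne).2)
          have z2 (j k) : adjoinTwo (numIndepAbove M (r + 2)) (insert i J) j k = 0 := by
            by_contra hne
            unfold adjoinTwo at hne
            split_ifs at hne
            · exact hne rfl
            · exact hI (M.indep_subset ((Finset.subset_insert _ _).trans (Finset.subset_insert _ _))
                (indep_insert_of_adjoin_ne_zero M hne).2)
          simp only [z0, z1, z2, mul_zero, zero_mul, Finset.sum_const_zero, add_zero]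
          positivity
      have hsum := Finset.sum_le_sum fun i (_ : i ∈ Finset.univ) => hterm i
      rw [← Finset.mul_sum] at hsum
      refine le_of_mul_le_mul_left (le_trans (le_of_eq ?_) hsum) hd1
      have t0 : ∑ i, adjoin (numIndepAbove M r) J i = ((d : ℝ) + 1) * numIndepAbove M r J := by
        rw [sum_adjoin, hrJ]
      have t1 (j) : ∑ i, adjoinTwo (numIndepAbove M (r + 1)) J i j =
          ((d : ℝ) + 1) * adjoin (numIndepAbove M (r + 1)) J j := by
        simp only [adjoinTwo_comm _ J _ j]
        rw [sum_adjoinTwo]; push_cast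
        linear_combination adjoin (numIndepAbove M (r + 1)) J j * hrJ
      have t2 (j k) : ∑ i, adjoinThree (numIndepAbove M (r + 2)) J i j k =
          ((d : ℝ) + 1) * adjoinTwo (numIndepAbove M (r + 2)) J j k := by
        simp only [adjoinThree_comm_left _ J _ j k, adjoinThree_comm_right _ J j _ k]
        rw [sum_adjoinThree]; push_cast
        linear_combination adjoinTwo (numIndepAbove M (r + 2)) J j k * hrJ
      have e (i) : (if i ∈ J then 0 else
          b * b' * numIndepAbove M r (insert i J) * a ^ 2 +
          2 * a * ∑ j, b * adjoin (numIndepAbove M (r + 1)) (insert i J) j * h j +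
          ∑ j, ∑ k, adjoinTwo (numIndepAbove M (r + 2)) (insert i J) j k * h j * h k) =
          b * b' * a ^ 2 * adjoin (numIndepAbove M r) J i +
          2 * a * ∑ j, b * h j * adjoinTwo (numIndepAbove M (r + 1)) J i j +
          ∑ j, ∑ k, h j * h k * adjoinThree (numIndepAbove M (r + 2)) J i j k := by
        split_ifs with hiJ
        · simp [adjoin, adjoinTwo, adjoinThree, hiJ]
        · rw [adjoin, if_neg hiJ]
          congr 1
          · congr 1
            · ring
            · congr 1
              exact Finset.sum_congr rfl fun j _ => by rw [adjoinTwo, if_neg hiJ]; ring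
          · exact Finset.sum_congr rfl fun j _ => Finset.sum_congr rfl fun k _ => by
              rw [adjoinThree, if_neg hiJ]; ring
      simp only [e]
      rw [Finset.sum_add_distrib, Finset.sum_add_distrib, ← Finset.mul_sum, ← Finset.mul_sum, t0]
      have f1 : ∑ i, ∑ j, b * h j * adjoinTwo (numIndepAbove M (r + 1)) J i j =
          ((d : ℝ) + 1) * ∑ j, b * adjoin (numIndepAbove M (r + 1)) J j * h j := by
        rw [Finset.sum_comm, Finset.mul_sum]
        refine Finset.sum_congr rfl fun j _ => ?_
        rw [← Finset.mul_sum, t1]; ring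
      have f2 : ∑ i, ∑ j, ∑ k, h j * h k * adjoinThree (numIndepAbove M (r + 2)) J i j k =
          ((d : ℝ) + 1) * ∑ j, ∑ k, adjoinTwo (numIndepAbove M (r + 2)) J j k * h j * h k := by
        rw [Finset.sum_comm, Finset.mul_sum]
        refine Finset.sum_congr rfl fun j _ => ?_
        rw [Finset.sum_comm, Finset.mul_sum]
        refine Finset.sum_congr rfl fun k _ => ?_
        rw [← Finset.mul_sum, t2]; ring
      rw [f1, f2]
      ring
    · intro g hg
      by_cases hex : ∃ i, i ∉ J ∧ M.Indep (insert i J)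
      · obtain ⟨i, hi, hiJ⟩ := hex
        refine ⟨g i, fun j hj => ?_⟩
        obtain ⟨hj, hjJ⟩ := (hrow j).1 hj
        have hi2 : ∑ k, adjoinTwo (numIndepAbove M (r + 2)) J i k ≠ 0 := (hrow i).2 ⟨hi, hiJ⟩
        obtain ⟨k, -, hk⟩ := Finset.exists_ne_zero_of_sum_ne_zero hi2
        rcases adjoinTwo_ne_zero_or M h0 (by omega) hk hj hjJ with h | h
        · exact (hg i j h).symm
        · rw [hg i k hk, hg j k h]
      · exact ⟨0, fun i hi => absurd ⟨i, (hrow i).1 hi⟩ hex⟩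

end

section

variable {n : ℕ} (M : PaperMatroid n)

lemma numIndepAbove_empty (k : ℕ) : numIndepAbove M k ∅ = numIndep M k := by
  classical
  simp [numIndepAbove, numIndep, Nat.card_eq_fintype_card, Fintype.card_subtype]

lemma numIndep_of_lt {k : ℕ} (hk : matRank M < k) : numIndep M k = 0 := by
  classical
  rw [← Nat.cast_eq_zero (R := ℝ), ← numIndepAbove_empty]
  by_contra h
  obtain ⟨K, -, hK, rfl⟩ := (numIndepAbove_ne_zero_iff M k ∅).1 h
  have : K.card ≤ matRank M := by
    unfold matRank
    exact Finset.le_sup (f := Finset.card) (Finset.mem_filter.2 ⟨Finset.mem_univ K, hK⟩)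
  omega

lemma matRank_le : matRank M ≤ n :=
  Finset.sup_le fun K _ => (Finset.card_le_univ K).trans_eq (Fintype.card_fin n)

lemma numIndep_ne_zero_of_succ {k : ℕ} (h : numIndep M (k + 1) ≠ 0) : numIndep M k ≠ 0 := by
  rw [← Nat.cast_ne_zero (R := ℝ), ← numIndepAbove_empty, numIndepAbove_ne_zero_iff] at h ⊢
  obtain ⟨K, -, hK, hc⟩ := h
  obtain ⟨L, hL, hLc⟩ := Finset.exists_subset_card_eq (show k ≤ K.card by omega)
  exact ⟨L, Finset.empty_subset L, M.indep_subset hL hK, hLc⟩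

/-- Ultra-log-concavity of the numbers of independent sets (the strong Mason conjecture). -/
lemma numIndep_mul_le (r : ℕ) (hr : r + 2 ≤ n) :
    ((r : ℝ) + 2) * ((n : ℝ) - r) * numIndep M r * numIndep M (r + 2) ≤
      ((r : ℝ) + 1) * ((n : ℝ) - (r + 1)) * numIndep M (r + 1) ^ 2 := by
  have h := reverse_cauchy_adjoin M r hr r ∅ (by simp) 1 0
  simp only [sum_adjoinTwo, ← Finset.mul_sum, sum_adjoin, numIndepAbove_empty,
    Finset.card_empty, Pi.zero_apply, mul_zero, Finset.sum_const_zero, add_zero, one_mul] at h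
  push_cast at h
  have hb : (0 : ℝ) < (n : ℝ) - (r + 1) := by
    have : (r : ℝ) + 2 ≤ n := by exact_mod_cast hr
    linarith
  refine le_of_mul_le_mul_left ?_ (mul_pos hb (show (0 : ℝ) < r + 1 by positivity))
  refine le_trans (le_of_eq ?_) (h.trans (le_of_eq ?_)) <;> ring

lemma isLogConcaveSeq_of_mul_le_sq {c : ℕ → ℝ} (h0 : ∀ k, 0 ≤ c k)
    (hz : ∀ k, c k = 0 → c (k + 1) = 0) (h : ∀ k, c k * c (k + 2) ≤ c (k + 1) ^ 2) :
    IsLogConcaveSeq c := by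
  refine ⟨h0, fun i j hij => ?_⟩
  induction j, hij using Nat.le_induction with
  | base => exact (mul_comm _ _).le
  | succ j hij ih =>
    rcases (h0 (j + 1)).eq_or_lt with hj | hj
    · rw [hz _ hj.symm, mul_zero]
      exact mul_nonneg (h0 _) (h0 _)
    · refine le_of_mul_le_mul_right ?_ hj
      calc c i * c (j + 1 + 1) * c (j + 1) = c i * c (j + 1) * c (j + 2) := by ring
        _ ≤ c (i + 1) * c j * c (j + 2) := mul_le_mul_of_nonneg_right ih (h0 _)
        _ = c (i + 1) * (c j * c (j + 2)) := by ring
        _ ≤ c (i + 1) * c (j + 1) ^ 2 := mul_le_mul_of_nonneg_left (h j) (h0 _)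
        _ = c (i + 1) * c (j + 1) * c (j + 1) := by ring

lemma isLogConcaveSeq_numIndep_div_choose :
    IsLogConcaveSeq fun k => (numIndep M k : ℝ) / n.choose k := by
  refine isLogConcaveSeq_of_mul_le_sq (fun k => by positivity) (fun k hk => ?_) fun k => ?_
  · by_cases hkn : k ≤ n
    · have hc : (n.choose k : ℝ) ≠ 0 := by exact_mod_cast (Nat.choose_pos hkn).ne'
      have h1 : numIndep M k = 0 := by simpa [hc] using hk
      have h2 : numIndep M (k + 1) = 0 := by_contra fun h => numIndep_ne_zero_of_succ M h h1
      simp [h2]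
    · simp [Nat.choose_eq_zero_of_lt (show n < k + 1 by omega)]
  · by_cases hkn : k + 2 ≤ n
    · have h := numIndep_mul_le M k hkn
      have c0 : (0 : ℝ) < n.choose k := by exact_mod_cast Nat.choose_pos (by omega)
      have c1 : (0 : ℝ) < n.choose (k + 1) := by exact_mod_cast Nat.choose_pos (by omega)
      have c2 : (0 : ℝ) < n.choose (k + 2) := by exact_mod_cast Nat.choose_pos (by omega)
      have e1 : (n.choose (k + 1) : ℝ) * (k + 1) = n.choose k * ((n : ℝ) - k) := by
        have := Nat.choose_succ_right_eq n k
        rw [← Nat.cast_sub (by omega)]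
        exact_mod_cast this
      have e2 : (n.choose (k + 2) : ℝ) * (k + 2) = n.choose (k + 1) * ((n : ℝ) - (k + 1)) := by
        have := Nat.choose_succ_right_eq n (k + 1)
        rw [← Nat.cast_succ, ← Nat.cast_sub (by omega)]
        exact_mod_cast this
      have hnk : (0 : ℝ) < (k + 2) * ((n : ℝ) - k) := by
        have : (k : ℝ) + 2 ≤ n := by exact_mod_cast hkn
        exact mul_pos (by positivity) (by linarith)
      rw [div_mul_div_comm, div_pow, div_le_div_iff₀ (mul_pos c0 c2) (pow_pos c1 2)]
      refine le_of_mul_le_mul_left ?_ hnk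
      calc (k + 2) * ((n : ℝ) - k) *
            (numIndep M k * numIndep M (k + 2) * (n.choose (k + 1) : ℝ) ^ 2)
          = (k + 2) * ((n : ℝ) - k) * numIndep M k * numIndep M (k + 2) *
            (n.choose (k + 1) : ℝ) ^ 2 := by ring
        _ ≤ (k + 1) * ((n : ℝ) - (k + 1)) * numIndep M (k + 1) ^ 2 *
            (n.choose (k + 1) : ℝ) ^ 2 := by gcongr
        _ = (numIndep M (k + 1) : ℝ) ^ 2 * ((n.choose (k + 1) * (k + 1)) *
            (n.choose (k + 1) * ((n : ℝ) - (k + 1)))) := by ring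
        _ = _ := by rw [e1, ← e2]; ring
    · simp only [Nat.choose_eq_zero_of_lt (show n < k + 2 by omega), Nat.cast_zero, div_zero,
        mul_zero]
      positivity

lemma fM_eq_binaryForm :
    fM M = binaryForm n fun k => (numIndep M k : ℝ) / n.choose k := by
  have e : fM M = ∑ k ∈ Finset.range (n + 1),
      C (numIndep M k : ℝ) * X 0 ^ (n - k) * X 1 ^ k := by
    refine Finset.sum_subset (Finset.range_mono (Nat.succ_le_succ (matRank_le M))) fun k _ hk => ?_
    rw [numIndep_of_lt M (by simpa [Nat.lt_succ_iff] using hk)]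
    simp
  rw [e, binaryForm_eq_sum, ← Finset.Nat.sum_antidiagonal_swap]
  simp only [Prod.fst_swap, Prod.snd_swap]
  rw [Finset.Nat.sum_antidiagonal_eq_sum_range_succ_mk]
  refine Finset.sum_congr rfl fun k hk => ?_
  have hk : k ≤ n := Nat.lt_succ_iff.1 (Finset.mem_range.1 hk)
  have hc : (n.choose k : ℝ) ≠ 0 := by exact_mod_cast (Nat.choose_pos hk).ne'
  rw [Nat.choose_symm hk, ← map_natCast (C : ℝ →+* MvPolynomial (Fin 2) ℝ) (n.choose k),
    ← mul_assoc, ← mul_assoc, ← C_mul, mul_div_cancel₀ _ hc]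

end

/-- For any matroid `M` on `n` elements with `I_k` independent sets of size `k` and
rank `r`, the bivariate polynomial `f_M(y,z) = ∑_{k=0}^{r} I_k y^(n−k) z^k` is
completely log-concave. -/
theorem fM_completelyLogConcave {n : ℕ} (M : PaperMatroid n) :
    CompletelyLogConcave (fM M) := by
  rw [fM_eq_binaryForm]
  exact completelyLogConcave_binaryForm n (isLogConcaveSeq_numIndep_div_choose M)
end

section
/- If a bivariate polynomial f = Σ_{k=0}^{n} c_k · y^{n−k} · z^k ∈ ℝ[y,z] is completely log-concave, then the sequence c_0, …, c_n is ultra log-concave: for every k with 0 < k < n, (c_k / C(n,k))^2 ≥ (c_{k-1} / C(n,k-1)) · (c_{k+1} / C(n,k+1)). -/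
open Matrix MvPolynomial

theorem CompletelyLogConcave.logConcaveOn_foldr {m : ℕ} {f : MvPolynomial (Fin m) ℝ}
    (hf : CompletelyLogConcave f) (l : List (Fin m → ℝ)) (hl : ∀ v ∈ l, ∀ i, 0 ≤ v i) :
    LogConcaveOn (l.foldr dirDeriv f) := by
  simpa [List.ofFn_get] using hf l.length l.get fun j => hl _ (l.get_mem j)

theorem dirDeriv_single {m : ℕ} (i : Fin m) : dirDeriv (Pi.single i 1) = ⇑(pderiv (R := ℝ) i) := by
  funext f
  simp [dirDeriv, Pi.single_apply, apply_ite C, ite_mul]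

theorem CompletelyLogConcave.logConcaveOn_iterate_pderiv {m : ℕ} {f : MvPolynomial (Fin m) ℝ}
    (hf : CompletelyLogConcave f) (i j : Fin m) (p q : ℕ) :
    LogConcaveOn ((pderiv i)^[p] ((pderiv j)^[q] f)) := by
  have hnonneg (i : Fin m) : ∀ l, 0 ≤ (Pi.single i 1 : Fin m → ℝ) l := by
    have h : (0 : Fin m → ℝ) ≤ Pi.single i 1 := Pi.single_nonneg.2 zero_le_one
    exact h
  have h := hf.logConcaveOn_foldr
    (List.replicate p (Pi.single i 1) ++ List.replicate q (Pi.single j 1)) (by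
      intro v hv
      rcases List.mem_append.1 hv with hv | hv <;> rw [List.eq_of_mem_replicate hv] <;>
        exact hnonneg _)
  have hfold (v : Fin m → ℝ) (p : ℕ) (g : MvPolynomial (Fin m) ℝ) :
      (List.replicate p v).foldr dirDeriv g = (dirDeriv v)^[p] g := by
    induction p with
    | zero => rfl
    | succ p ih => rw [List.replicate_succ, List.foldr_cons, ih, Function.iterate_succ_apply']
  rwa [List.foldr_append, hfold, hfold, dirDeriv_single, dirDeriv_single] at h

theorem iterate_pderiv_zero_monomial (p a b : ℕ) (r : ℝ) :
    (pderiv 0)^[p] (C r * X 0 ^ a * X 1 ^ b : MvPolynomial (Fin 2) ℝ) =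
      C (r * a.descFactorial p) * X 0 ^ (a - p) * X 1 ^ b := by
  induction p with
  | zero => simp
  | succ p ih =>
    rw [Function.iterate_succ_apply', ih, Nat.descFactorial_succ, Nat.sub_add_eq]
    simp [Derivation.leibniz, Derivation.leibniz_pow, pderiv_X]
    ring

theorem iterate_pderiv_one_monomial (q a b : ℕ) (r : ℝ) :
    (pderiv 1)^[q] (C r * X 0 ^ a * X 1 ^ b : MvPolynomial (Fin 2) ℝ) =
      C (r * b.descFactorial q) * X 0 ^ a * X 1 ^ (b - q) := by
  induction q with
  | zero => simp
  | succ q ih =>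
    rw [Function.iterate_succ_apply', ih, Nat.descFactorial_succ, Nat.sub_add_eq]
    simp [Derivation.leibniz, Derivation.leibniz_pow, pderiv_X]
    ring

theorem iterate_pderiv_sum {m : ℕ} {ι : Type*} (i : Fin m) (p : ℕ) (s : Finset ι)
    (g : ι → MvPolynomial (Fin m) ℝ) :
    (pderiv i)^[p] (∑ k ∈ s, g k) = ∑ k ∈ s, (pderiv i)^[p] (g k) := by
  induction p with
  | zero => rfl
  | succ p ih => simp only [Function.iterate_succ_apply', ih, map_sum]

/-- Differentiating a binary form of degree `p + q + 2` down to degree two leaves, up to a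
constant, the quadratic form whose coefficients are the normalized ones. -/
theorem eval_iterate_pderiv_binary_form (p q : ℕ) (c : ℕ → ℝ) (x : Fin 2 → ℝ) :
    eval x ((pderiv 0)^[p] ((pderiv 1)^[q] (∑ k ∈ Finset.range (p + q + 2 + 1),
      C (c k) * X 0 ^ (p + q + 2 - k) * X 1 ^ k))) =
    ((p + q + 2).factorial / 2 : ℝ) *
      (c q / ((p + q + 2).choose q : ℝ) * x 0 ^ 2 +
        2 * (c (q + 1) / ((p + q + 2).choose (q + 1) : ℝ)) * x 0 * x 1 +
        c (q + 2) / ((p + q + 2).choose (q + 2) : ℝ) * x 1 ^ 2) := by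
  simp only [iterate_pderiv_sum, iterate_pderiv_one_monomial, iterate_pderiv_zero_monomial]
  simp only [map_sum, map_mul, map_pow, eval_C, eval_X]
  rw [show p + q + 2 + 1 = q + (3 + p) by ring, Finset.sum_range_add, Finset.sum_range_add,
    Finset.sum_eq_zero, Finset.sum_eq_zero (s := Finset.range p)]
  rotate_left
  · intro i _
    rw [Nat.descFactorial_of_lt (show p + q + 2 - (q + (3 + i)) < p by grind)]
    simp
  · intro i hi
    rw [Nat.descFactorial_of_lt (Finset.mem_range.1 hi)]
    simp
  have normalize (j : ℕ) (hj : j ≤ 2) :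
      c (q + j) * ((q + j).descFactorial q : ℝ) * ((p + q + 2 - (q + j)).descFactorial p : ℝ) *
        (j.factorial * (2 - j).factorial) =
      (p + q + 2).factorial * (c (q + j) / ((p + q + 2).choose (q + j) : ℝ)) := by
    have hc : ((p + q + 2).choose (q + j) : ℝ) ≠ 0 := by
      exact_mod_cast (Nat.choose_pos (by omega)).ne'
    have h1 := Nat.choose_mul_factorial_mul_factorial (show q + j ≤ p + q + 2 by omega)
    have h2 := Nat.factorial_mul_descFactorial (show q ≤ q + j by omega)
    have h3 := Nat.factorial_mul_descFactorial (show p ≤ p + q + 2 - (q + j) by omega)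
    rw [show q + j - q = j by omega] at h2
    rw [show p + q + 2 - (q + j) - p = 2 - j by omega] at h3
    rw [← h1, ← h2, ← h3]
    push_cast
    field_simp
  have h0 := normalize 0 (by norm_num)
  have h1 := normalize 1 (by norm_num)
  have h2 := normalize 2 (by norm_num)
  simp only [Finset.sum_range_succ, Finset.sum_range_zero, add_zero, zero_add,
    show p + q + 2 - q - p = 2 by omega, show p + q + 2 - (q + 1) - p = 1 by omega,
    show p + q + 2 - (q + 2) - p = 0 by omega, Nat.sub_self, Nat.add_sub_cancel_left] at h0 h1 h2 ⊢
  norm_num [Nat.factorial] at h0 h1 h2 ⊢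
  linear_combination (x 0 ^ 2 / 2) * h0 + (x 0 * x 1) * h1 + (x 1 ^ 2 / 2) * h2

/-- The discriminant of a log-concave binary quadratic form is nonnegative. -/
theorem LogConcaveOn.mul_le_sq_of_eval_eq {g : MvPolynomial (Fin 2) ℝ} (hg : LogConcaveOn g)
    {K a b d : ℝ} (hK : 0 < K)
    (heval : ∀ x, eval x g = K * (a * x 0 ^ 2 + 2 * b * x 0 * x 1 + d * x 1 ^ 2)) :
    a * d ≤ b ^ 2 := by
  obtain ⟨hpos, hlog⟩ := hg
  have ha : 0 ≤ a := by
    have := hpos ![1, 0] (by simp [Fin.forall_fin_two])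
    simp only [heval] at this
    simpa [hK] using this
  have hd : 0 ≤ d := by
    have := hpos ![0, 1] (by simp [Fin.forall_fin_two])
    simp only [heval] at this
    simpa [hK] using this
  obtain ⟨s, hs, rfl⟩ : ∃ s, 0 ≤ s ∧ s ^ 2 = a := ⟨√a, a.sqrt_nonneg, Real.sq_sqrt ha⟩
  obtain ⟨t, ht, rfl⟩ : ∃ t, 0 ≤ t ∧ t ^ 2 = d := ⟨√d, d.sqrt_nonneg, Real.sq_sqrt hd⟩
  rcases (mul_nonneg hs ht).eq_or_lt with hst | hst
  · rw [← mul_pow, ← hst]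
    simpa using sq_nonneg b
  have h := hlog ![2 * t, 0] ![0, 2 * s] (by simp [Fin.forall_fin_two, ht])
    (by simp [Fin.forall_fin_two, hs]) (1 / 2) (by norm_num) (by norm_num)
  have hu : eval ![2 * t, 0] g = K * (2 * (s * t)) ^ 2 := by
    simp only [heval, Matrix.cons_val_zero, Matrix.cons_val_one]; ring
  have hv : eval ![0, 2 * s] g = K * (2 * (s * t)) ^ 2 := by
    simp only [heval, Matrix.cons_val_zero, Matrix.cons_val_one]; ring
  have hroot (y : ℝ) (hy : 0 < y) : y ^ (1 / 2 : ℝ) * y ^ (1 - 1 / 2 : ℝ) = y := by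
    rw [← Real.rpow_add hy]; norm_num
  rw [hu, hv, hroot _ (by positivity), heval] at h
  simp at h
  have h' := le_of_mul_le_mul_left h hK
  have hb : s * t ≤ b := by
    refine le_of_mul_le_mul_left (?_ : s * t * (s * t) ≤ s * t * b) hst
    norm_num at h'
    linarith
  rw [← mul_pow]
  exact pow_le_pow_left₀ hst.le hb 2

/-- If the bivariate polynomial `f = ∑_{k=0}^{n} c_k y^(n−k) z^k` is completely
log-concave, then the coefficient sequence `c_0, …, c_n` is ultra log-concave. -/
theorem ultraLogConcave_of_completelyLogConcave (n : ℕ) (c : ℕ → ℝ)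
    (f : MvPolynomial (Fin 2) ℝ)
    (hf : f = ∑ k ∈ Finset.range (n+1),
      MvPolynomial.C (c k) * MvPolynomial.X 0 ^ (n - k) * MvPolynomial.X 1 ^ k)
    (hclc : CompletelyLogConcave f) :
    ∀ k : ℕ, 0 < k → k < n →
      (c (k-1) / (n.choose (k-1) : ℝ)) * (c (k+1) / (n.choose (k+1) : ℝ)) ≤
        (c k / (n.choose k : ℝ)) ^ 2 := by
  rintro k hk hkn
  obtain ⟨q, rfl⟩ : ∃ q, k = q + 1 := ⟨k - 1, by omega⟩
  obtain ⟨p, rfl⟩ : ∃ p, n = p + q + 2 := ⟨n - q - 2, by omega⟩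
  subst hf
  exact (hclc.logConcaveOn_iterate_pderiv 0 1 p q).mul_le_sq_of_eval_eq (by positivity)
    (eval_iterate_pderiv_binary_form p q c)
end

section
/- Let f ∈ ℝ[z_1,…,z_n] be homogeneous of degree d ≥ 2 with nonnegative coefficients, let a ∈ ℝ_{≥0}^n with f(a) ≠ 0, and let Q = ∇²f(a) be the Hessian matrix of f at a. Then f is log-concave at a if and only if the quadratic form z ↦ zᵀQz is negative semidefinite on the orthogonal complement of the vector Qa (i.e., zᵀQz ≤ 0 for all z ∈ ℝ^n with zᵀQa = 0). -/
open Matrix MvPolynomial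

/-- The Hessian matrix `∇²f(a)` of `f` at the point `a`. -/
noncomputable def hessAt {m : ℕ} (f : MvPolynomial (Fin m) ℝ) (a : Fin m → ℝ) :
    Matrix (Fin m) (Fin m) ℝ :=
  fun i j => MvPolynomial.eval a (MvPolynomial.pderiv i (MvPolynomial.pderiv j f))

/-- The Hessian of `log f` at `a`, namely `(f(a)·∇²f(a) − ∇f(a)·∇f(a)ᵀ) / f(a)²`. -/
noncomputable def logHessAt {m : ℕ} (f : MvPolynomial (Fin m) ℝ) (a : Fin m → ℝ) :
    Matrix (Fin m) (Fin m) ℝ :=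
  fun i j =>
    (MvPolynomial.eval a f * hessAt f a i j -
        MvPolynomial.eval a (MvPolynomial.pderiv i f) *
          MvPolynomial.eval a (MvPolynomial.pderiv j f)) /
      (MvPolynomial.eval a f) ^ 2

/-- A matrix `N` is negative semidefinite if `xᵀNx ≤ 0` for all `x`. -/
def IsNegSemidef {m : ℕ} (N : Matrix (Fin m) (Fin m) ℝ) : Prop :=
  ∀ x : Fin m → ℝ, x ⬝ᵥ (N *ᵥ x) ≤ 0

/-- `f` is log-concave at the point `a`: the Hessian of `log f` at `a` is
negative semidefinite. -/
def LogConcaveAt {m : ℕ} (f : MvPolynomial (Fin m) ℝ) (a : Fin m → ℝ) : Prop :=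
  IsNegSemidef (logHessAt f a)

theorem MvPolynomial.pderiv_pderiv_comm {σ R : Type*} [CommRing R] (i j : σ)
    (f : MvPolynomial σ R) : pderiv i (pderiv j f) = pderiv j (pderiv i f) := by
  classical
  have h : ⁅pderiv (R := R) i, pderiv (R := R) j⁆ = 0 := by
    apply MvPolynomial.derivation_ext
    intro k
    simp [Derivation.commutator_apply, pderiv_X, Pi.single_apply, apply_ite]
  simpa [Derivation.commutator_apply, sub_eq_zero] using
    congrArg (fun D : Derivation R (MvPolynomial σ R) (MvPolynomial σ R) => D f) h

theorem MvPolynomial.eval_nonneg_of_coeff_nonneg {σ : Type*} {f : MvPolynomial σ ℝ}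
    (hf : ∀ m, 0 ≤ f.coeff m) {a : σ → ℝ} (ha : ∀ i, 0 ≤ a i) : 0 ≤ eval a f := by
  rw [eval_eq]
  exact Finset.sum_nonneg fun m _ =>
    mul_nonneg (hf m) (Finset.prod_nonneg fun i _ => pow_nonneg (ha i) _)

theorem Matrix.IsSymm.dotProduct_mulVec_comm {m R : Type*} [Fintype m] [CommSemiring R]
    {A : Matrix m m R} (hA : A.IsSymm) (x y : m → R) : x ⬝ᵥ (A *ᵥ y) = y ⬝ᵥ (A *ᵥ x) := by
  rw [dotProduct_mulVec, ← mulVec_transpose, hA.eq, dotProduct_comm]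

/-- The gradient `∇f(a)` of `f` at the point `a`. -/
noncomputable def gradAt {m : ℕ} (f : MvPolynomial (Fin m) ℝ) (a : Fin m → ℝ) : Fin m → ℝ :=
  fun i => eval a (pderiv i f)

theorem hessAt_isSymm {m : ℕ} (f : MvPolynomial (Fin m) ℝ) (a : Fin m → ℝ) :
    (hessAt f a).IsSymm := by
  ext i j
  simp only [transpose_apply, hessAt, pderiv_pderiv_comm i j]

/-- Euler's identity for the gradient. -/
theorem gradAt_dotProduct_self {m d : ℕ} {f : MvPolynomial (Fin m) ℝ} (hf : f.IsHomogeneous d)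
    (a : Fin m → ℝ) : gradAt f a ⬝ᵥ a = d * eval a f := by
  simpa [dotProduct, gradAt, mul_comm] using congrArg (eval a) hf.sum_X_mul_pderiv

/-- Euler's identity for the Hessian. -/
theorem hessAt_mulVec_self {m d : ℕ} {f : MvPolynomial (Fin m) ℝ} (hf : f.IsHomogeneous d)
    (a : Fin m → ℝ) : hessAt f a *ᵥ a = ((d : ℝ) - 1) • gradAt f a := by
  ext i
  have h := congrArg (fun p => eval a (pderiv i p)) hf.sum_X_mul_pderiv
  simp only [map_sum, Derivation.leibniz, Derivation.map_natCast, smul_eq_mul, map_add, map_mul,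
    eval_X, pderiv_X, Pi.single_apply, nsmul_eq_mul, map_natCast, Finset.sum_add_distrib] at h
  simp only [apply_ite (eval a), map_one, map_zero, mul_ite, mul_one, mul_zero,
    Finset.sum_ite_eq', Finset.mem_univ, if_true] at h
  simp only [mulVec, dotProduct, hessAt, gradAt, Pi.smul_apply, smul_eq_mul]
  simp only [mul_comm _ (a _)]
  linarith

theorem logConcaveAt_iff {m : ℕ} {f : MvPolynomial (Fin m) ℝ} {a : Fin m → ℝ}
    (hF : 0 < eval a f) :
    LogConcaveAt f a ↔
      ∀ x : Fin m → ℝ, eval a f * (x ⬝ᵥ (hessAt f a *ᵥ x)) - (gradAt f a ⬝ᵥ x) ^ 2 ≤ 0 := by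
  have h : logHessAt f a = ((eval a f) ^ 2)⁻¹ •
      (eval a f • hessAt f a - vecMulVec (gradAt f a) (gradAt f a)) := by
    ext i j
    simp [logHessAt, gradAt, vecMulVec_apply, div_eq_inv_mul]
  refine forall_congr' fun x => ?_
  have hx : x ⬝ᵥ (logHessAt f a *ᵥ x) = ((eval a f) ^ 2)⁻¹ *
      (eval a f * (x ⬝ᵥ (hessAt f a *ᵥ x)) - (gradAt f a ⬝ᵥ x) ^ 2) := by
    simp [h, smul_mulVec, sub_mulVec, vecMulVec_mulVec, dotProduct_comm x (gradAt f a), sq]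
  rw [hx]
  have : 0 < ((eval a f) ^ 2)⁻¹ := by positivity
  exact ⟨fun h => nonpos_of_mul_nonpos_right h this, mul_nonpos_of_nonneg_of_nonpos this.le⟩

/-- Let `f` be homogeneous of degree `d ≥ 2` with nonnegative coefficients,
`a ∈ ℝ_{≥0}^n` with `f(a) ≠ 0`, and `Q = ∇²f(a)`. Then `f` is log-concave at `a` iff
the quadratic form `z ↦ zᵀQz` is negative semidefinite on the orthogonal complement
of `Qa`. -/
theorem logConcaveAt_iff_negSemidef_on_orth {n d : ℕ} (hd : 2 ≤ d)
    (f : MvPolynomial (Fin n) ℝ)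
    (hhom : f.IsHomogeneous d) (hcoeff : ∀ m, 0 ≤ f.coeff m)
    (a : Fin n → ℝ) (ha : ∀ i, 0 ≤ a i) (hfa : MvPolynomial.eval a f ≠ 0) :
    LogConcaveAt f a ↔
      ∀ z : Fin n → ℝ, z ⬝ᵥ (hessAt f a *ᵥ a) = 0 → z ⬝ᵥ (hessAt f a *ᵥ z) ≤ 0 := by
  have hF : 0 < MvPolynomial.eval a f :=
    lt_of_le_of_ne (eval_nonneg_of_coeff_nonneg hcoeff ha) hfa.symm
  have hd' : (2 : ℝ) ≤ d := by exact_mod_cast hd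
  rw [logConcaveAt_iff hF]
  have hQa := hessAt_mulVec_self hhom a
  have hga := gradAt_dotProduct_self hhom a
  constructor
  · intro h z hz
    rw [hQa, dotProduct_smul, smul_eq_mul, mul_eq_zero, dotProduct_comm] at hz
    have hgz : gradAt f a ⬝ᵥ z = 0 := hz.resolve_left (by linarith)
    have := h z
    rw [hgz] at this
    nlinarith
  · intro h x
    set t : ℝ := (gradAt f a ⬝ᵥ x) / (d * MvPolynomial.eval a f) with ht
    have htx : gradAt f a ⬝ᵥ x = t * (d * MvPolynomial.eval a f) := by
      rw [ht]
      field_simp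
    have hz : (x - t • a) ⬝ᵥ (hessAt f a *ᵥ a) = 0 := by
      rw [hQa, dotProduct_smul, dotProduct_comm, dotProduct_sub, dotProduct_smul, hga, htx]
      simp
    have hx : x ⬝ᵥ (hessAt f a *ᵥ x) =
        (x - t • a) ⬝ᵥ (hessAt f a *ᵥ (x - t • a)) +
          t ^ 2 * ((d - 1) * (d * MvPolynomial.eval a f)) := by
      have hsymm := (hessAt_isSymm f a).dotProduct_mulVec_comm a x
      have hxa : x ⬝ᵥ (hessAt f a *ᵥ a) = (d - 1) * (t * (d * MvPolynomial.eval a f)) := by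
        rw [hQa, dotProduct_smul, dotProduct_comm, htx, smul_eq_mul]
      have haa : a ⬝ᵥ (hessAt f a *ᵥ a) = (d - 1) * (d * MvPolynomial.eval a f) := by
        rw [hQa, dotProduct_smul, dotProduct_comm, hga, smul_eq_mul]
      simp only [mulVec_sub, mulVec_smul, sub_dotProduct, dotProduct_sub, smul_dotProduct,
        dotProduct_smul, smul_eq_mul, hsymm, hxa, haa]
      ring
    have hle := mul_nonpos_of_nonneg_of_nonpos hF.le (h _ hz)
    rw [hx, htx]
    have : 0 ≤ (t * MvPolynomial.eval a f) ^ 2 * d := by positivity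
    nlinarith
end

section
/- Let Q ∈ ℝ^{n×n} be a symmetric matrix and a ∈ ℝ^n with aᵀQa > 0. If the quadratic form z ↦ zᵀQz is negative semidefinite on some linear subspace L ⊆ ℝ^n of dimension n−1, then the matrix (aᵀQa)·Q − (Qa)(Qa)ᵀ is negative semidefinite. -/
open Matrix MvPolynomial

/-- A vector outside a subspace of dimension `n - 1` spans a complement of that subspace. -/
theorem exists_sub_smul_mem_of_finrank_eq_pred {K V : Type*} [Field K] [AddCommGroup V]
    [Module K V] [FiniteDimensional K V] {L : Submodule K V}
    (hL : Module.finrank K L = Module.finrank K V - 1) {a : V} (ha : a ∉ L) (x : V) :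
    ∃ s : K, x - s • a ∈ L := by
  have hpos : 0 < Module.finrank K V :=
    Module.finrank_pos_iff_exists_ne_zero.2 ⟨a, fun h => ha (h ▸ L.zero_mem)⟩
  have hquot : Module.finrank K (V ⧸ L) = 1 := by
    have := L.finrank_quotient_add_finrank
    omega
  have hne : L.mkQ a ≠ 0 := by simpa using ha
  obtain ⟨s, hs⟩ := (finrank_eq_one_iff_of_nonzero' (L.mkQ a) hne).1 hquot (L.mkQ x)
  refine ⟨s, (Submodule.Quotient.mk_eq_zero L).1 ?_⟩
  change L.mkQ (x - s • a) = 0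
  rw [map_sub, map_smul, hs, sub_self]

/-- If `Q` is symmetric, `aᵀQa > 0`, and `z ↦ zᵀQz` is negative semidefinite on some
linear subspace of dimension `n−1`, then `(aᵀQa)·Q − (Qa)(Qa)ᵀ` is negative
semidefinite. -/
theorem negSemidef_of_negSemidef_on_hyperplane {n : ℕ}
    (Q : Matrix (Fin n) (Fin n) ℝ) (hQ : Q.IsSymm)
    (a : Fin n → ℝ) (ha : 0 < a ⬝ᵥ (Q *ᵥ a))
    (L : Submodule ℝ (Fin n → ℝ)) (hL : Module.finrank ℝ L = n - 1)
    (hneg : ∀ z ∈ L, z ⬝ᵥ (Q *ᵥ z) ≤ 0) :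
    IsNegSemidef ((a ⬝ᵥ (Q *ᵥ a)) • Q - Matrix.vecMulVec (Q *ᵥ a) (Q *ᵥ a)) := by
  intro x
  have haL : a ∉ L := fun h => (hneg a h).not_gt ha
  obtain ⟨s, hs⟩ := exists_sub_smul_mem_of_finrank_eq_pred (by simpa using hL) haL x
  have hsymm : a ⬝ᵥ (Q *ᵥ x) = x ⬝ᵥ (Q *ᵥ a) := by
    rw [dotProduct_mulVec, ← mulVec_transpose, hQ.eq, dotProduct_comm]
  have hz := hneg _ hs
  simp only [mulVec_sub, mulVec_smul, sub_dotProduct, dotProduct_sub, smul_dotProduct,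
    dotProduct_smul, smul_eq_mul, hsymm] at hz
  simp only [sub_mulVec, smul_mulVec, vecMulVec_mulVec, dotProduct_sub, dotProduct_smul,
    smul_eq_mul, op_smul_eq_smul,
    dotProduct_comm (Q *ᵥ a) x]
  nlinarith [mul_nonpos_of_nonneg_of_nonpos ha.le hz,
    sq_nonneg (s * (a ⬝ᵥ (Q *ᵥ a)) - x ⬝ᵥ (Q *ᵥ a))]
end
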